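/- arXiv:2311.12322 — 12 statements merged into one kernel-verified Lean document; each statement's English description precedes it below -/
import Mathlib

section
/- Let n, m be positive integers, A, C be n×n real matrices, B, D be n×m real matrices, σ > 0, and K be an m×n real matrix; write F = A + BK and G = C + DK. Suppose there exists a symmetric positive definite n×n matrix P₀ such that Fᵀ P₀ F + σ² Gᵀ P₀ G − P₀ is negative definite. Then for every symmetric n×n matrix M, the discrete generalized Lyapunov equation P = Fᵀ P F + σ² Gᵀ P G + M admits a unique symmetric solution P. -/
open Matrix Filter

theorem aux_conj {n : ℕ} (F P : Matrix (Fin n) (Fin n) ℝ) (x : Fin n → ℝ) :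
    x ⬝ᵥ ((Fᵀ * P * F) *ᵥ x) = (F *ᵥ x) ⬝ᵥ (P *ᵥ (F *ᵥ x)) := by
  rw [← Matrix.mulVec_mulVec, ← Matrix.mulVec_mulVec, Matrix.dotProduct_mulVec,
    Matrix.vecMul_transpose]

theorem aux_L {n : ℕ} (F G P : Matrix (Fin n) (Fin n) ℝ) (s : ℝ) (x : Fin n → ℝ) :
    x ⬝ᵥ ((Fᵀ * P * F + s • (Gᵀ * P * G)) *ᵥ x) =
      (F *ᵥ x) ⬝ᵥ (P *ᵥ (F *ᵥ x)) + s * ((G *ᵥ x) ⬝ᵥ (P *ᵥ (G *ᵥ x))) := by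
  rw [Matrix.add_mulVec, dotProduct_add, Matrix.smul_mulVec, dotProduct_smul, aux_conj, aux_conj,
    smul_eq_mul]

theorem aux_zero {n : ℕ} (P : Matrix (Fin n) (Fin n) ℝ) (hs : P.IsSymm)
    (h : ∀ x : Fin n → ℝ, x ⬝ᵥ (P *ᵥ x) = 0) : P = 0 := by
  ext i j
  have h1 := h (Pi.single i 1 + Pi.single j 1)
  have h2 := h (Pi.single i 1)
  have h3 := h (Pi.single j 1)
  have h4 := hs.apply i j
  simp [Matrix.mulVec_add] at h1 h2 h3
  simp
  linarith

theorem aux_inj {n : ℕ} (hn : 0 < n) (F G P₀ P : Matrix (Fin n) (Fin n) ℝ) (s : ℝ) (hs : 0 ≤ s)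
    (hP₀ : ∀ x : Fin n → ℝ, x ≠ 0 → 0 < x ⬝ᵥ (P₀ *ᵥ x))
    (hst : ∀ x : Fin n → ℝ, x ≠ 0 →
      x ⬝ᵥ ((Fᵀ * P₀ * F + s • (Gᵀ * P₀ * G)) *ᵥ x) < x ⬝ᵥ (P₀ *ᵥ x))
    (hsym : P.IsSymm) (hP : P = Fᵀ * P * F + s • (Gᵀ * P * G)) : P = 0 := by
  apply aux_zero P hsym
  haveI : Nonempty (Fin n) := ⟨⟨0, hn⟩⟩
  have hne : (Metric.sphere (0 : Fin n → ℝ) 1).Nonempty :=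
    NormedSpace.sphere_nonempty.2 zero_le_one
  have h0 : ∀ x ∈ Metric.sphere (0 : Fin n → ℝ) 1, x ≠ 0 := by
    rintro x hx rfl
    simp at hx
  obtain ⟨x, hx, hmax⟩ := (isCompact_sphere (0 : Fin n → ℝ) 1).exists_isMaxOn hne
    (f := fun x => |x ⬝ᵥ (P *ᵥ x)| / (x ⬝ᵥ (P₀ *ᵥ x))) (by
      apply ContinuousOn.div
      · exact (by fun_prop : Continuous fun x : Fin n → ℝ => |x ⬝ᵥ (P *ᵥ x)|).continuousOn
      · exact (by fun_prop : Continuous fun x : Fin n → ℝ => x ⬝ᵥ (P₀ *ᵥ x)).continuousOn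
      · intro x hx
        exact (hP₀ x (h0 x hx)).ne')
  have hx0 := h0 x hx
  have hp := hP₀ x hx0
  obtain ⟨c, hc⟩ : ∃ c, c = |x ⬝ᵥ (P *ᵥ x)| / (x ⬝ᵥ (P₀ *ᵥ x)) := ⟨_, rfl⟩
  have hc0 : 0 ≤ c := by rw [hc]; positivity
  have hb : ∀ y : Fin n → ℝ, |y ⬝ᵥ (P *ᵥ y)| ≤ c * (y ⬝ᵥ (P₀ *ᵥ y)) := by
    intro y
    by_cases hy : y = 0
    · simp [hy]
    have hny : 0 < ‖y‖ := norm_pos_iff.2 hy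
    have hm : ‖y‖⁻¹ • y ∈ Metric.sphere (0 : Fin n → ℝ) 1 := by
      simp [norm_smul, hny.ne']
    have h1 := hmax hm
    simp only [Set.mem_setOf_eq] at h1
    rw [← hc, div_le_iff₀ (hP₀ _ (h0 _ hm))] at h1
    simp only [Matrix.mulVec_smul, dotProduct_smul, smul_dotProduct, smul_eq_mul, abs_mul,
      abs_inv, abs_norm] at h1
    have h2 := mul_le_mul_of_nonneg_left h1 (mul_pos hny hny).le
    field_simp at h2
    linarith
  have hcx : |x ⬝ᵥ (P *ᵥ x)| = c * (x ⬝ᵥ (P₀ *ᵥ x)) := by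
    rw [hc]; field_simp
  have e1 : x ⬝ᵥ (P *ᵥ x) =
      (F *ᵥ x) ⬝ᵥ (P *ᵥ (F *ᵥ x)) + s * ((G *ᵥ x) ⬝ᵥ (P *ᵥ (G *ᵥ x))) := by
    rw [← aux_L, ← hP]
  have e2 := hst x hx0
  rw [aux_L] at e2
  have e3 := abs_add_le ((F *ᵥ x) ⬝ᵥ (P *ᵥ (F *ᵥ x))) (s * ((G *ᵥ x) ⬝ᵥ (P *ᵥ (G *ᵥ x))))
  rw [← e1, abs_mul, abs_of_nonneg hs, hcx] at e3
  have e4 := hb (F *ᵥ x)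
  have e5 := mul_le_mul_of_nonneg_left (hb (G *ᵥ x)) hs
  have hc1 : c = 0 := by
    by_contra hne
    have := mul_lt_mul_of_pos_left e2 (lt_of_le_of_ne hc0 (Ne.symm hne))
    linarith
  intro y
  have := hb y
  rw [hc1, zero_mul] at this
  exact abs_nonpos_iff.1 this

theorem lyapunov_unique_symmetric_solution
    (n m : ℕ) (hn : 0 < n) (hm : 0 < m)
    (A C : Matrix (Fin n) (Fin n) ℝ) (B D : Matrix (Fin n) (Fin m) ℝ)
    (σ : ℝ) (hσ : 0 < σ) (K : Matrix (Fin m) (Fin n) ℝ)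
    (F G : Matrix (Fin n) (Fin n) ℝ)
    (hF : F = A + B * K) (hG : G = C + D * K)
    (P₀ : Matrix (Fin n) (Fin n) ℝ) (hP₀ : P₀.PosDef)
    (hstab : (-(Fᵀ * P₀ * F + σ ^ 2 • (Gᵀ * P₀ * G) - P₀)).PosDef) :
    ∀ M : Matrix (Fin n) (Fin n) ℝ, M.IsSymm →
      ∃! P : Matrix (Fin n) (Fin n) ℝ,
        P.IsSymm ∧ P = Fᵀ * P * F + σ ^ 2 • (Gᵀ * P * G) + M := by
  intro M hM
  have key : ∀ P : Matrix (Fin n) (Fin n) ℝ, P.IsSymm →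
      P = Fᵀ * P * F + σ ^ 2 • (Gᵀ * P * G) → P = 0 := by
    intro P hs hP
    refine aux_inj hn F G P₀ P (σ ^ 2) (sq_nonneg σ) ?_ ?_ hs hP
    · intro x hx
      simpa using hP₀.dotProduct_mulVec_pos hx
    · intro x hx
      have := hstab.dotProduct_mulVec_pos hx
      rw [Matrix.neg_mulVec, Matrix.sub_mulVec, dotProduct_neg, dotProduct_sub] at this
      simp only [star_trivial] at this
      linarith
  let S : Submodule ℝ (Matrix (Fin n) (Fin n) ℝ) :=
    { carrier := {P | P.IsSymm}
      add_mem' := fun ha hb => Matrix.IsSymm.add ha hb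
      zero_mem' := Matrix.isSymm_zero
      smul_mem' := fun c _ h => Matrix.IsSymm.smul h c }
  let T : Matrix (Fin n) (Fin n) ℝ →ₗ[ℝ] Matrix (Fin n) (Fin n) ℝ :=
    { toFun := fun P => P - (Fᵀ * P * F + σ ^ 2 • (Gᵀ * P * G))
      map_add' := by
        intro P Q
        simp only [mul_add, add_mul, smul_add]
        abel
      map_smul' := by
        intro c P
        simp only [Matrix.mul_smul, Matrix.smul_mul, smul_sub, smul_add, RingHom.id_apply,
          smul_comm c (σ ^ 2)] }
  have hT : ∀ P, T P = P - (Fᵀ * P * F + σ ^ 2 • (Gᵀ * P * G)) := fun _ => rfl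
  have hmem : ∀ P ∈ S, T P ∈ S := by
    intro P (hP : P.IsSymm)
    change (T P)ᵀ = T P
    rw [hT]
    simp [Matrix.transpose_mul, hP.eq, Matrix.mul_assoc]
  have hinj : Function.Injective (T.restrict hmem) := by
    rw [← LinearMap.ker_eq_bot, LinearMap.ker_eq_bot']
    rintro ⟨P, hP⟩ h
    have h' : T P = 0 := congrArg Subtype.val h
    rw [hT, sub_eq_zero] at h'
    exact Subtype.ext (key P hP h')
  obtain ⟨⟨P, hP⟩, hPM⟩ := LinearMap.surjective_of_injective hinj ⟨M, hM⟩
  have hPM' : T P = M := congrArg Subtype.val hPM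
  refine ⟨P, ⟨hP, ?_⟩, ?_⟩
  · rw [← hPM', hT]; abel
  · rintro Q ⟨hQ, hQM⟩
    have hQ' : T Q = M := by
      rw [hT, sub_eq_iff_eq_add, add_comm]; exact hQM
    have : (⟨Q, hQ⟩ : S) = ⟨P, hP⟩ := hinj (Subtype.ext (hQ'.trans hPM'.symm))
    exact congrArg Subtype.val this
end

section
/- Let n, m be positive integers, A, C be n×n real matrices, B, D be n×m real matrices, σ > 0, and K be an m×n real matrix; write F = A + BK and G = C + DK. If there exists a symmetric positive definite n×n matrix P such that Fᵀ P F + σ² Gᵀ P G − P is negative definite, then for every initial state ξ ∈ ℝⁿ the second-moment sequence M₀ = ξ ξᵀ, M_{t+1} = F M_t Fᵀ + σ² G M_t Gᵀ satisfies trace(M_t) → 0 as t → ∞. -/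
open Matrix Filter

open scoped MatrixOrder in
lemma aux_lower {n : ℕ} (hn : 0 < n) (Q : Matrix (Fin n) (Fin n) ℝ) (hQ : Q.PosDef) :
    ∃ c : ℝ, 0 < c ∧ (Q - c • (1 : Matrix (Fin n) (Fin n) ℝ)).PosSemidef := by
  haveI : Nonempty (Fin n) := ⟨⟨0, hn⟩⟩
  have h := (CFC.exists_pos_algebraMap_le_iff (A := Matrix (Fin n) (Fin n) ℝ) (a := Q)
    hQ.isHermitian).2 (by
      intro x hx
      rw [hQ.isHermitian.spectrum_real_eq_range_eigenvalues] at hx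
      obtain ⟨i, rfl⟩ := hx
      exact hQ.eigenvalues_pos i)
  obtain ⟨c, hc, h⟩ := h
  refine ⟨c, hc, ?_⟩
  rw [Matrix.le_iff, Algebra.algebraMap_eq_smul_one] at h
  exact h

open scoped MatrixOrder in
lemma aux_trace {n : ℕ} (Q M : Matrix (Fin n) (Fin n) ℝ) (hQ : Q.PosSemidef)
    (hM : M.PosSemidef) : 0 ≤ (Q * M).trace := by
  obtain ⟨L, rfl⟩ := CStarAlgebra.nonneg_iff_eq_star_mul_self.mp hM.nonneg
  rw [← mul_assoc, trace_mul_comm, ← mul_assoc]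
  exact (hQ.mul_mul_conjTranspose_same L).trace_nonneg

theorem mean_square_stable_of_lyapunov
    (n m : ℕ) (hn : 0 < n) (hm : 0 < m)
    (A C : Matrix (Fin n) (Fin n) ℝ) (B D : Matrix (Fin n) (Fin m) ℝ)
    (σ : ℝ) (hσ : 0 < σ) (K : Matrix (Fin m) (Fin n) ℝ)
    (F G : Matrix (Fin n) (Fin n) ℝ)
    (hF : F = A + B * K) (hG : G = C + D * K)
    (P : Matrix (Fin n) (Fin n) ℝ) (hP : P.PosDef)
    (hstab : (-(Fᵀ * P * F + σ ^ 2 • (Gᵀ * P * G) - P)).PosDef) :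
    ∀ ξ : Fin n → ℝ, ∀ M : ℕ → Matrix (Fin n) (Fin n) ℝ,
      M 0 = vecMulVec ξ ξ →
      (∀ t, M (t + 1) = F * M t * Fᵀ + σ ^ 2 • (G * M t * Gᵀ)) →
      Tendsto (fun t => (M t).trace) atTop (nhds 0) := by
  intro ξ M h0 hS
  have hM : ∀ t, (M t).PosSemidef := by
    intro t
    induction t with
    | zero => rw [h0]; simpa using posSemidef_vecMulVec_self_star ξ
    | succ t ih =>
      rw [hS]
      have h1 := ih.mul_mul_conjTranspose_same F
      have h2 := ih.mul_mul_conjTranspose_same G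
      rw [conjTranspose_eq_transpose_of_trivial] at h1 h2
      exact h1.add (h2.smul (sq_nonneg σ))
  obtain ⟨c, hc, hQ⟩ := aux_lower hn _ hstab
  have hstep : ∀ t, c * (M t).trace ≤ (P * M t).trace - (P * M (t + 1)).trace := by
    intro t
    have h := aux_trace _ _ hQ (hM t)
    have e1 : ∀ H : Matrix (Fin n) (Fin n) ℝ,
        (P * (H * M t * Hᵀ)).trace = (Hᵀ * P * H * M t).trace := by
      intro H
      rw [← mul_assoc, trace_mul_comm]
      simp only [mul_assoc]
    rw [hS, mul_add, trace_add, mul_smul_comm, trace_smul, e1, e1]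
    simp only [sub_mul, neg_mul, add_mul, smul_mul_assoc, one_mul, trace_sub, trace_neg,
      trace_add, trace_smul, smul_eq_mul] at h ⊢
    linarith
  have hsum : ∀ N, ∑ t ∈ Finset.range N, c * (M t).trace ≤ (P * M 0).trace := by
    intro N
    have h1 := Finset.sum_le_sum (fun t (_ : t ∈ Finset.range N) => hstep t)
    rw [Finset.sum_range_sub' (fun t => (P * M t).trace)] at h1
    have := aux_trace _ _ hP.posSemidef (hM N)
    linarith
  have hs := summable_of_sum_range_le
    (fun t => mul_nonneg hc.le (hM t).trace_nonneg) hsum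
  have := hs.tendsto_atTop_zero.const_mul c⁻¹
  simpa [← mul_assoc, inv_mul_cancel₀ hc.ne'] using this
end

section
/- Let n, m be positive integers, A, C be n×n real matrices, B, D be n×m real matrices, σ > 0, and K be an m×n real matrix; write F = A + BK and G = C + DK. If for every initial state ξ ∈ ℝⁿ the second-moment sequence M₀ = ξ ξᵀ, M_{t+1} = F M_t Fᵀ + σ² G M_t Gᵀ satisfies trace(M_t) → 0 as t → ∞, then there exists a symmetric positive definite n×n matrix P such that Fᵀ P F + σ² Gᵀ P G − P is negative definite. -/
open Matrix Filter

open scoped MatrixOrder Matrix.Norms.L2Operator in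
theorem psd_le_trace {n : ℕ} (X : Matrix (Fin n) (Fin n) ℝ) (hX : X.PosSemidef) (x : Fin n → ℝ) :
    x ⬝ᵥ (X *ᵥ x) ≤ X.trace * (x ⬝ᵥ x) := by
  obtain ⟨S, rfl⟩ : ∃ S : Matrix (Fin n) (Fin n) ℝ, X = Sᵀ * S := by
    obtain ⟨S, hS⟩ := CStarAlgebra.nonneg_iff_eq_star_mul_self.mp hX.nonneg
    exact ⟨S, by simpa [star_eq_conjTranspose, conjTranspose_eq_transpose_of_trivial] using hS⟩
  have h1 : x ⬝ᵥ ((Sᵀ * S) *ᵥ x) = ∑ i, (∑ j, S i j * x j) ^ 2 := by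
    rw [← mulVec_mulVec, dotProduct_mulVec, vecMul_transpose]
    simp [dotProduct, mulVec, sq]
  have h2 : (Sᵀ * S).trace = ∑ i, ∑ j, S i j ^ 2 := by
    rw [Finset.sum_comm]
    simp [trace, mul_apply, sq]
  have h3 : x ⬝ᵥ x = ∑ j, x j ^ 2 := by simp [dotProduct, sq]
  rw [h1, h2, h3, Finset.sum_mul]
  exact Finset.sum_le_sum fun i _ => Finset.sum_mul_sq_le_sq_mul_sq _ _ _

theorem lyapunov_of_mean_square_stable
    (n m : ℕ) (hn : 0 < n) (hm : 0 < m)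
    (A C : Matrix (Fin n) (Fin n) ℝ) (B D : Matrix (Fin n) (Fin m) ℝ)
    (σ : ℝ) (hσ : 0 < σ) (K : Matrix (Fin m) (Fin n) ℝ)
    (F G : Matrix (Fin n) (Fin n) ℝ)
    (hF : F = A + B * K) (hG : G = C + D * K)
    (hms : ∀ ξ : Fin n → ℝ, ∀ M : ℕ → Matrix (Fin n) (Fin n) ℝ,
      M 0 = vecMulVec ξ ξ →
      (∀ t, M (t + 1) = F * M t * Fᵀ + σ ^ 2 • (G * M t * Gᵀ)) →
      Tendsto (fun t => (M t).trace) atTop (nhds 0)) :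
    ∃ P : Matrix (Fin n) (Fin n) ℝ, P.PosDef ∧
      (-(Fᵀ * P * F + σ ^ 2 • (Gᵀ * P * G) - P)).PosDef := by
  clear hF hG
  let L : Matrix (Fin n) (Fin n) ℝ → Matrix (Fin n) (Fin n) ℝ :=
    fun M => F * M * Fᵀ + σ ^ 2 • (G * M * Gᵀ)
  let T : Matrix (Fin n) (Fin n) ℝ → Matrix (Fin n) (Fin n) ℝ :=
    fun P => Fᵀ * P * F + σ ^ 2 • (Gᵀ * P * G)
  have hadj : ∀ M Y, (L M * Y).trace = (M * T Y).trace := by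
    intro M Y
    simp only [L, T, add_mul, mul_add, smul_mul_assoc, mul_smul_comm, trace_add, trace_smul]
    congr 1
    · rw [mul_assoc F, mul_assoc F, trace_mul_comm]; simp only [mul_assoc]
    · congr 1
      rw [mul_assoc G, mul_assoc G, trace_mul_comm]; simp only [mul_assoc]
  have hadjt : ∀ (t : ℕ) M Y, (L^[t] M * Y).trace = (M * T^[t] Y).trace := by
    intro t
    induction t with
    | zero => intro M Y; rfl
    | succ t ih =>
      intro M Y
      rw [Function.iterate_succ_apply, ih, hadj, Function.iterate_succ_apply']
  have hpsd : ∀ t : ℕ, (T^[t] 1).PosSemidef := by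
    intro t
    induction t with
    | zero => exact PosSemidef.one
    | succ t ih =>
      rw [Function.iterate_succ_apply']
      have h1 := ih.conjTranspose_mul_mul_same F
      have h2 := ih.conjTranspose_mul_mul_same G
      rw [conjTranspose_eq_transpose_of_trivial] at h1 h2
      exact h1.add (h2.smul (sq_nonneg σ))
  have htr : Tendsto (fun t : ℕ => (T^[t] 1).trace) atTop (nhds 0) := by
    have h : ∀ i : Fin n, Tendsto (fun t : ℕ => (T^[t] 1) i i) atTop (nhds 0) := by
      intro i
      have := hms (Pi.single i 1) (fun t => L^[t] (vecMulVec (Pi.single i 1) (Pi.single i 1))) rfl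
        (fun t => by simp only [Function.iterate_succ_apply']; rfl)
      refine this.congr fun t => ?_
      have h := hadjt t (vecMulVec (Pi.single i 1) (Pi.single i 1)) 1
      rw [mul_one] at h
      rw [h, vecMulVec_mul, trace_vecMulVec]
      simp
    have := tendsto_finsetSum (Finset.univ : Finset (Fin n)) (fun i _ => h i)
    simpa [trace] using this
  obtain ⟨N, hN1, hN⟩ : ∃ N : ℕ, 1 ≤ N ∧ (T^[N] 1).trace < 1 :=
    ((eventually_ge_atTop 1).and (htr.eventually (gt_mem_nhds one_pos))).exists
  have hTsum : ∀ k : ℕ, T (∑ t ∈ Finset.range k, T^[t] 1) - ∑ t ∈ Finset.range k, T^[t] 1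
      = T^[k] 1 - 1 := by
    intro k
    induction k with
    | zero => simp [T]
    | succ k ih =>
      have hadd : ∀ X Y, T (X + Y) = T X + T Y := by
        intro X Y
        simp only [T, add_mul, mul_add, smul_add]; abel
      rw [Finset.sum_range_succ, hadd, Function.iterate_succ_apply']
      rw [← sub_eq_zero] at ih ⊢
      rw [← ih]; abel
  refine ⟨∑ t ∈ Finset.range N, T^[t] 1, ?_, ?_⟩
  · obtain ⟨k, rfl⟩ : ∃ k, N = k + 1 := ⟨N - 1, by omega⟩
    rw [Finset.sum_range_succ']
    exact PosDef.posSemidef_add (posSemidef_sum _ fun i _ => hpsd _) PosDef.one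
  · change (-(T (∑ t ∈ Finset.range N, T^[t] 1) - _)).PosDef
    rw [hTsum, neg_sub]
    refine PosDef.of_dotProduct_mulVec_pos (isHermitian_one.sub (hpsd N).isHermitian) ?_
    intro x hx
    have h1 := psd_le_trace _ (hpsd N) x
    have h2 : 0 < x ⬝ᵥ x := by
      have := (dotProduct_star_self_pos_iff (v := x)).mpr hx
      simpa using this
    rw [sub_mulVec, one_mulVec, dotProduct_sub]
    simp only [star_trivial]
    nlinarith
end

section
/- Let n, m be positive integers, A, C ∈ ℝ^{n×n}, B, D ∈ ℝ^{n×m}, σ > 0, and let K ∈ ℝ^{m×n} be a stabilizer, i.e. there exists a positive definite P₀ with F_Kᵀ P₀ F_K + σ² G_Kᵀ P₀ G_K − P₀ negative definite, where F_K = A + BK and G_K = C + DK. Let Q ∈ ℝ^{n×n} be symmetric, S ∈ ℝ^{m×n}, R ∈ ℝ^{m×m} symmetric, and suppose P_K is a symmetric matrix satisfying the Lyapunov equation P_K = F_Kᵀ P_K F_K + σ² G_Kᵀ P_K G_K + Q_K, where Q_K = Q + Kᵀ S + Sᵀ K + Kᵀ R K. Then for every initial state ξ ∈ ℝⁿ,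 the series ∑_{t=0}^∞ trace(Q_K M_t) converges and equals ξᵀ P_K ξ, where M₀ = ξ ξᵀ and M_{t+1} = F_K M_t F_Kᵀ + σ² G_K M_t G_Kᵀ. -/
open Matrix Filter

open scoped MatrixOrder Matrix.Norms.L2Operator in
theorem aux_factor {n : ℕ} (W : Matrix (Fin n) (Fin n) ℝ) (h : W.PosDef) :
    ∃ U : Matrix (Fin n) (Fin n) ℝ, IsUnit U ∧ W = Uᵀ * U := by
  obtain ⟨y, hy, e⟩ := CStarAlgebra.isStrictlyPositive_iff_eq_star_mul_self.mp h.isStrictlyPositive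
  exact ⟨y, hy, by rw [e, star_eq_conjTranspose, conjTranspose_eq_transpose_of_trivial]⟩

theorem aux_conj_s5 {n : ℕ} {N : Matrix (Fin n) (Fin n) ℝ} (h : N.PosSemidef)
    (U : Matrix (Fin n) (Fin n) ℝ) : (U * N * Uᵀ).PosSemidef := by
  have := h.mul_mul_conjTranspose_same U
  rwa [conjTranspose_eq_transpose_of_trivial] at this

theorem aux_entry {n : ℕ} (N : Matrix (Fin n) (Fin n) ℝ) (h : N.PosSemidef) (i j : Fin n) :
    |N i j| ≤ N.trace := by
  have hd : ∀ k, 0 ≤ N k k := fun k => h.diag_nonneg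
  have ht : ∀ k, N k k ≤ N.trace := fun k =>
    Finset.single_le_sum (f := fun k => N k k) (fun k _ => hd k) (Finset.mem_univ k)
  have hs : N j i = N i j := by
    have := h.1.apply i j
    simpa using this
  have h1 := h.dotProduct_mulVec_nonneg (Pi.single i 1 + Pi.single j 1)
  have h2 := h.dotProduct_mulVec_nonneg (Pi.single i 1 - Pi.single j 1)
  simp [mulVec_add, mulVec_sub, add_dotProduct, sub_dotProduct, hs] at h1 h2
  have := ht i
  have := ht j
  rw [abs_le]
  constructor <;> linarith

theorem aux_step {n : ℕ} (F G P M : Matrix (Fin n) (Fin n) ℝ) (s : ℝ) :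
    (P * (F * M * Fᵀ + s • (G * M * Gᵀ))).trace = ((Fᵀ * P * F + s • (Gᵀ * P * G)) * M).trace := by
  have key : ∀ F : Matrix (Fin n) (Fin n) ℝ, (P * (F * M * Fᵀ)).trace = (Fᵀ * P * F * M).trace := by
    intro F
    rw [← mul_assoc, trace_mul_comm]
    simp only [mul_assoc]
  simp [mul_add, add_mul, key]

theorem aux_zero_s5 {n : ℕ} (F G P₀ : Matrix (Fin n) (Fin n) ℝ) (s : ℝ) (hs : 0 ≤ s)
    (hP : P₀.PosDef) (hW : (-(Fᵀ * P₀ * F + s • (Gᵀ * P₀ * G) - P₀)).PosDef)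
    (M : ℕ → Matrix (Fin n) (Fin n) ℝ) (h0 : (M 0).PosSemidef)
    (hM : ∀ t, M (t + 1) = F * M t * Fᵀ + s • (G * M t * Gᵀ)) :
    Tendsto M atTop (nhds 0) := by
  have hpsd : ∀ t, (M t).PosSemidef := by
    intro t
    induction t with
    | zero => exact h0
    | succ t ih =>
      rw [hM]
      exact (aux_conj_s5 ih F).add ((aux_conj_s5 ih G).smul hs)
  obtain ⟨V, -, hV⟩ := aux_factor _ hP
  obtain ⟨U, hU, hUW⟩ := aux_factor _ hW
  have tr : ∀ (U N : Matrix (Fin n) (Fin n) ℝ), (Uᵀ * U * N).trace = (U * N * Uᵀ).trace := by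
    intro U N
    rw [mul_assoc, trace_mul_comm]
  have hPn : ∀ t, 0 ≤ (P₀ * M t).trace := fun t => by
    rw [hV, tr]; exact (aux_conj_s5 (hpsd t) V).trace_nonneg
  have hdiff : ∀ t, (U * M t * Uᵀ).trace = (P₀ * M t).trace - (P₀ * M (t+1)).trace := by
    intro t
    rw [← tr, ← hUW, hM, aux_step, ← trace_sub, ← sub_mul, neg_sub]
  have hsum : Summable (fun t => (U * M t * Uᵀ).trace) := by
    refine summable_of_sum_range_le (c := (P₀ * M 0).trace)
      (fun t => (aux_conj_s5 (hpsd t) U).trace_nonneg) fun N => ?_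
    simp only [hdiff]
    rw [Finset.sum_range_sub' (fun t => (P₀ * M t).trace)]
    linarith [hPn N]
  have hN : Tendsto (fun t => U * M t * Uᵀ) atTop (nhds 0) := by
    refine tendsto_pi_nhds.mpr fun i => ?_
    refine tendsto_pi_nhds.mpr fun j => ?_
    exact squeeze_zero_norm (fun t => aux_entry _ (aux_conj_s5 (hpsd t) U) i j)
      hsum.tendsto_atTop_zero
  have hdet : IsUnit U.det := (isUnit_iff_isUnit_det U).mp hU
  have e : ∀ t, M t = U⁻¹ * (U * M t * Uᵀ) * (U⁻¹)ᵀ := by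
    intro t
    have h1 : Uᵀ * (U⁻¹)ᵀ = 1 := by rw [← transpose_mul, nonsing_inv_mul _ hdet, transpose_one]
    rw [mul_assoc U, nonsing_inv_mul_cancel_left _ _ hdet, mul_assoc, h1, mul_one]
  have hc : Continuous (fun X : Matrix (Fin n) (Fin n) ℝ => U⁻¹ * X * (U⁻¹)ᵀ) := by fun_prop
  have := (hc.tendsto 0).comp hN
  simp only [mul_zero, zero_mul] at this
  exact this.congr fun t => (e t).symm

theorem cost_eq_quadratic_form_of_lyapunov
    (n m : ℕ) (hn : 0 < n) (hm : 0 < m)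
    (A C : Matrix (Fin n) (Fin n) ℝ) (B D : Matrix (Fin n) (Fin m) ℝ)
    (σ : ℝ) (hσ : 0 < σ) (K : Matrix (Fin m) (Fin n) ℝ)
    (hK : ∃ P₀ : Matrix (Fin n) (Fin n) ℝ, P₀.PosDef ∧
      (-((A + B * K)ᵀ * P₀ * (A + B * K) +
          σ ^ 2 • ((C + D * K)ᵀ * P₀ * (C + D * K)) - P₀)).PosDef)
    (Q : Matrix (Fin n) (Fin n) ℝ) (hQ : Q.IsSymm)
    (S : Matrix (Fin m) (Fin n) ℝ)
    (R : Matrix (Fin m) (Fin m) ℝ) (hR : R.IsSymm)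
    (PK : Matrix (Fin n) (Fin n) ℝ) (hPK : PK.IsSymm)
    (hlyap : PK = (A + B * K)ᵀ * PK * (A + B * K) +
        σ ^ 2 • ((C + D * K)ᵀ * PK * (C + D * K)) +
        (Q + Kᵀ * S + Sᵀ * K + Kᵀ * R * K)) :
    ∀ ξ : Fin n → ℝ, ∀ M : ℕ → Matrix (Fin n) (Fin n) ℝ,
      M 0 = vecMulVec ξ ξ →
      (∀ t, M (t + 1) = (A + B * K) * M t * (A + B * K)ᵀ +
          σ ^ 2 • ((C + D * K) * M t * (C + D * K)ᵀ)) →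
      Tendsto
        (fun N => ∑ t ∈ Finset.range N,
          ((Q + Kᵀ * S + Sᵀ * K + Kᵀ * R * K) * M t).trace)
        atTop (nhds (ξ ⬝ᵥ PK *ᵥ ξ)) := by
  intro ξ M h0 hM
  obtain ⟨P₀, hP, hW⟩ := hK
  have hz := aux_zero_s5 _ _ P₀ (σ ^ 2) (sq_nonneg σ) hP hW M
    (by rw [h0]; simpa using posSemidef_vecMulVec_self_star ξ) hM
  have hsum : ∀ N, ∑ t ∈ Finset.range N, ((Q + Kᵀ * S + Sᵀ * K + Kᵀ * R * K) * M t).trace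
      = (PK * M 0).trace - (PK * M N).trace := by
    intro N
    rw [← Finset.sum_range_sub' (fun t => (PK * M t).trace)]
    refine Finset.sum_congr rfl fun t _ => ?_
    rw [hM, aux_step, ← trace_sub, ← sub_mul]
    congr 2
    exact eq_sub_of_add_eq' hlyap.symm
  simp only [hsum]
  have hc : Continuous (fun X : Matrix (Fin n) (Fin n) ℝ => (PK * M 0).trace - (PK * X).trace) := by
    fun_prop
  have hv : (PK * M 0).trace = ξ ⬝ᵥ PK *ᵥ ξ := by
    rw [h0, mul_vecMulVec, trace_vecMulVec, dotProduct_comm]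
  have := (hc.tendsto 0).comp hz
  simp only [mul_zero, trace_zero, sub_zero] at this
  rw [← hv]
  exact this
end

section
/- Let n, m be positive integers, A, C ∈ ℝ^{n×n}, B, D ∈ ℝ^{n×m}, σ > 0, Q ∈ ℝ^{n×n} symmetric, S ∈ ℝ^{m×n}, R ∈ ℝ^{m×m} symmetric positive definite with Q − Sᵀ R⁻¹ S positive definite. Suppose P is a symmetric positive definite n×n matrix such that, with K = −(R + Bᵀ P B + σ² Dᵀ P D)⁻¹ (Bᵀ P A + σ² Dᵀ P C + S), the equation (A+BK)ᵀ P (A+BK) + σ² (C+DK)ᵀ P (C+DK) + Kᵀ R K + Kᵀ S + Sᵀ K + Q − P = 0 holds. Then for every initial state ξ ∈ ℝⁿ: (i) the cost of the feedback gain K satisfies J(K, ξ) = ξᵀ P ξ, and (ii) for every stabilizer K̃ ∈ ℝ^{m×n}, J(K̃, ξ) ≥ ξᵀ P ξ; i.e. among all stabilizing linear state-feedback controls, u = Kx is optimal and the value is ξᵀ P ξ. -/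
open Matrix Filter

/-- `K` is a (mean-square) stabilizer of the system `[A, C; B, D]` with noise
intensity `σ`, characterized by the Lyapunov criterion. -/
def IsStabilizer {n m : ℕ} (A C : Matrix (Fin n) (Fin n) ℝ)
    (B D : Matrix (Fin n) (Fin m) ℝ) (σ : ℝ)
    (K : Matrix (Fin m) (Fin n) ℝ) : Prop :=
  ∃ P : Matrix (Fin n) (Fin n) ℝ, P.PosDef ∧
    (-((A + B * K)ᵀ * P * (A + B * K) +
        σ ^ 2 • ((C + D * K)ᵀ * P * (C + D * K)) - P)).PosDef

section Helpers
open scoped MatrixOrder Matrix.Norms.L2Operator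

lemma psd_factor {n : ℕ} {W : Matrix (Fin n) (Fin n) ℝ} (h : W.PosSemidef) :
    ∃ Y : Matrix (Fin n) (Fin n) ℝ, W = Yᵀ * Y := by
  obtain ⟨B, hB⟩ := CStarAlgebra.nonneg_iff_eq_star_mul_self.mp h.nonneg
  exact ⟨B, by simpa [star_eq_conjTranspose, conjTranspose_eq_transpose_of_trivial] using hB⟩

end Helpers

lemma psd_conj {n k : ℕ} {W : Matrix (Fin n) (Fin n) ℝ} (h : W.PosSemidef)
    (Y : Matrix (Fin k) (Fin n) ℝ) : (Y * W * Yᵀ).PosSemidef := by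
  simpa [conjTranspose_eq_transpose_of_trivial] using h.mul_mul_conjTranspose_same Y

lemma psd_conj2 {n k : ℕ} {W : Matrix (Fin n) (Fin n) ℝ} (h : W.PosSemidef)
    (Y : Matrix (Fin n) (Fin k) ℝ) : (Yᵀ * W * Y).PosSemidef := by
  simpa [conjTranspose_eq_transpose_of_trivial] using h.conjTranspose_mul_mul_same Y

lemma psd_smul {n : ℕ} {W : Matrix (Fin n) (Fin n) ℝ} (h : W.PosSemidef)
    (s : ℝ) : (s ^ 2 • W).PosSemidef := h.smul (sq_nonneg s)

lemma pd_symm {n : ℕ} {W : Matrix (Fin n) (Fin n) ℝ} (h : W.PosSemidef) : Wᵀ = W := by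
  simpa [conjTranspose_eq_transpose_of_trivial] using h.isHermitian.eq

lemma psd_trace {n : ℕ} {X M : Matrix (Fin n) (Fin n) ℝ} (hX : X.PosSemidef)
    (hM : M.PosSemidef) : 0 ≤ (X * M).trace := by
  obtain ⟨Y, rfl⟩ := psd_factor hX
  rw [Matrix.mul_assoc, trace_mul_comm]
  exact (psd_conj hM Y).trace_nonneg

lemma psd_entry {n : ℕ} {M : Matrix (Fin n) (Fin n) ℝ}
    (hM : M.PosSemidef) (i j : Fin n) : |M i j| ≤ M.trace := by
  have hd : ∀ i, M i i ≤ M.trace := fun i =>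
    Finset.single_le_sum (f := fun i => M i i) (fun k _ => hM.diag_nonneg) (Finset.mem_univ i)
  have hs : M j i = M i j := congrFun (congrFun (pd_symm hM) i) j
  have h1 := hM.dotProduct_mulVec_nonneg (Pi.single i 1 + Pi.single j 1)
  have h2 := hM.dotProduct_mulVec_nonneg (Pi.single i 1 - Pi.single j 1)
  simp [mulVec_add, mulVec_sub, add_dotProduct, sub_dotProduct] at h1 h2
  have := hd i
  have := hd j
  rw [abs_le]
  constructor <;> linarith

section Rec
variable {n : ℕ} {F G : Matrix (Fin n) (Fin n) ℝ} {s : ℝ} {M : ℕ → Matrix (Fin n) (Fin n) ℝ}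

lemma rec_psd (h0 : (M 0).PosSemidef)
    (hM : ∀ t, M (t + 1) = F * M t * Fᵀ + s ^ 2 • (G * M t * Gᵀ)) (t : ℕ) :
    (M t).PosSemidef := by
  induction t with
  | zero => exact h0
  | succ t ih =>
    rw [hM]
    exact (psd_conj ih F).add (psd_smul (psd_conj ih G) s)

lemma rec_trace (hM : ∀ t, M (t + 1) = F * M t * Fᵀ + s ^ 2 • (G * M t * Gᵀ))
    (P : Matrix (Fin n) (Fin n) ℝ) (t : ℕ) :
    (P * M (t + 1)).trace = ((Fᵀ * P * F + s ^ 2 • (Gᵀ * P * G)) * M t).trace := by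
  have key : ∀ F : Matrix (Fin n) (Fin n) ℝ,
      (P * (F * M t * Fᵀ)).trace = (Fᵀ * P * F * M t).trace := by
    intro F
    rw [← Matrix.mul_assoc, trace_mul_comm]
    simp only [Matrix.mul_assoc]
  rw [hM, mul_add, add_mul, trace_add, trace_add, mul_smul_comm, smul_mul_assoc,
    trace_smul, trace_smul, key, key]

lemma rec_summable (h0 : (M 0).PosSemidef)
    (hM : ∀ t, M (t + 1) = F * M t * Fᵀ + s ^ 2 • (G * M t * Gᵀ))
    {P W : Matrix (Fin n) (Fin n) ℝ} (hP : P.PosSemidef) (hW : W.PosDef)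
    (hPW : Fᵀ * P * F + s ^ 2 • (Gᵀ * P * G) = P - W)
    (Z : Matrix (Fin n) (Fin n) ℝ) : Summable (fun t => (Z * M t).trace) := by
  have hpsd := rec_psd h0 hM
  have hstep : ∀ t, (P * M (t + 1)).trace = (P * M t).trace - (W * M t).trace := by
    intro t
    rw [rec_trace hM, hPW, sub_mul, trace_sub]
  have hsumW : Summable (fun t => (W * M t).trace) := by
    refine summable_of_sum_range_le (c := (P * M 0).trace)
      (fun t => psd_trace hW.posSemidef (hpsd t)) (fun N => ?_)
    have : ∑ t ∈ Finset.range N, (W * M t).trace = (P * M 0).trace - (P * M N).trace := by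
      induction N with
      | zero => simp
      | succ N ih => rw [Finset.sum_range_succ, ih, hstep]; ring
    rw [this]
    linarith [psd_trace hP (hpsd N)]
  obtain ⟨Y, hY⟩ := psd_factor hW.posSemidef
  have hYu : IsUnit Y.det := by
    have := (isUnit_iff_isUnit_det _).1 hW.isUnit
    rw [hY, det_mul, det_transpose] at this
    exact isUnit_of_mul_isUnit_left this
  have hN : ∀ i j, Summable (fun t => (Y * M t * Yᵀ) i j) := by
    intro i j
    refine Summable.of_norm_bounded hsumW (fun t => ?_)
    have h := psd_entry (psd_conj (hpsd t) Y) i j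
    rw [Real.norm_eq_abs]
    refine h.trans (le_of_eq ?_)
    rw [hY, trace_mul_comm, Matrix.mul_assoc]
  have hE : ∀ t, (Z * M t).trace
      = ∑ i, ∑ j, (Y⁻¹ᵀ * Z * Y⁻¹) i j * (Y * M t * Yᵀ) j i := by
    intro t
    have h1 : (Z * M t).trace = ((Y⁻¹ᵀ * Z * Y⁻¹) * (Y * M t * Yᵀ)).trace := by
      have h2 : (Y⁻¹ᵀ * Z * Y⁻¹) * (Y * M t * Yᵀ) = Y⁻¹ᵀ * (Z * ((Y⁻¹ * Y) * (M t * Yᵀ))) := by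
        simp only [Matrix.mul_assoc]
      have h3 : Yᵀ * Y⁻¹ᵀ = 1 := by
        rw [← transpose_mul, nonsing_inv_mul _ hYu, transpose_one]
      rw [h2, nonsing_inv_mul _ hYu, Matrix.one_mul, trace_mul_comm Y⁻¹ᵀ]
      simp only [Matrix.mul_assoc, h3, Matrix.mul_one]
    rw [h1]
    simp [trace, Matrix.mul_apply (M := Y⁻¹ᵀ * Z * Y⁻¹)]
  simp only [hE]
  exact summable_sum fun i _ => summable_sum fun j _ => (hN j i).mul_left _

lemma rec_telescope (P : Matrix (Fin n) (Fin n) ℝ)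
    (hs : Summable (fun t => (P * M t).trace)) :
    HasSum (fun t => (P * M t).trace - (P * M (t + 1)).trace) (P * M 0).trace := by
  have h1 := hs.hasSum
  have h2 := ((summable_nat_add_iff 1).2 hs).hasSum
  have h3 := h1.sub h2
  rwa [hs.tsum_eq_zero_add, add_sub_cancel_right] at h3

end Rec

theorem riccati_gain_is_optimal
    (n m : ℕ) (hn : 0 < n) (hm : 0 < m)
    (A C : Matrix (Fin n) (Fin n) ℝ) (B D : Matrix (Fin n) (Fin m) ℝ)
    (σ : ℝ) (hσ : 0 < σ)
    (Q : Matrix (Fin n) (Fin n) ℝ) (hQ : Q.IsSymm)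
    (S : Matrix (Fin m) (Fin n) ℝ)
    (R : Matrix (Fin m) (Fin m) ℝ) (hR : R.PosDef)
    (hQS : (Q - Sᵀ * R⁻¹ * S).PosDef)
    (P : Matrix (Fin n) (Fin n) ℝ) (hP : P.PosDef)
    (K : Matrix (Fin m) (Fin n) ℝ)
    (hK : K = -(R + Bᵀ * P * B + σ ^ 2 • (Dᵀ * P * D))⁻¹ *
        (Bᵀ * P * A + σ ^ 2 • (Dᵀ * P * C) + S))
    (hric : (A + B * K)ᵀ * P * (A + B * K) +
        σ ^ 2 • ((C + D * K)ᵀ * P * (C + D * K)) +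
        Kᵀ * R * K + Kᵀ * S + Sᵀ * K + Q - P = 0) :
    ∀ ξ : Fin n → ℝ,
      (∀ M : ℕ → Matrix (Fin n) (Fin n) ℝ,
        M 0 = vecMulVec ξ ξ →
        (∀ t, M (t + 1) = (A + B * K) * M t * (A + B * K)ᵀ +
            σ ^ 2 • ((C + D * K) * M t * (C + D * K)ᵀ)) →
        HasSum (fun t => ((Q + Kᵀ * S + Sᵀ * K + Kᵀ * R * K) * M t).trace)
          (ξ ⬝ᵥ P *ᵥ ξ)) ∧
      (∀ K' : Matrix (Fin m) (Fin n) ℝ, IsStabilizer A C B D σ K' →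
        ∀ M' : ℕ → Matrix (Fin n) (Fin n) ℝ,
          M' 0 = vecMulVec ξ ξ →
          (∀ t, M' (t + 1) = (A + B * K') * M' t * (A + B * K')ᵀ +
              σ ^ 2 • ((C + D * K') * M' t * (C + D * K')ᵀ)) →
          ξ ⬝ᵥ P *ᵥ ξ ≤
            ∑' t, ((Q + K'ᵀ * S + Sᵀ * K' + K'ᵀ * R * K') * M' t).trace) := by
  intro ξ
  have hRs := pd_symm hR.posSemidef
  have hPs := pd_symm hP.posSemidef
  have hRu : IsUnit R.det := (isUnit_iff_isUnit_det _).1 hR.isUnit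
  have hval : (P * vecMulVec ξ ξ).trace = ξ ⬝ᵥ P *ᵥ ξ := by
    rw [mul_vecMulVec, trace_vecMulVec, dotProduct_comm]
  have hpsd0 : (vecMulVec ξ ξ).PosSemidef := by
    simpa using posSemidef_vecMulVec_self_star ξ
  constructor
  · intro M h0 hM
    have hW : (Q + Kᵀ * S + Sᵀ * K + Kᵀ * R * K).PosDef := by
      have h1 := hQS.add_posSemidef (psd_conj2 hR.posSemidef (K + R⁻¹ * S))
      convert h1 using 1
      have h2 : R⁻¹ᵀ = R⁻¹ := by rw [transpose_nonsing_inv, hRs]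
      have h3 : ∀ X : Matrix (Fin m) (Fin n) ℝ, R * (R⁻¹ * X) = X := fun X => by
        rw [← Matrix.mul_assoc, mul_nonsing_inv _ hRu, Matrix.one_mul]
      have h4 : ∀ X : Matrix (Fin m) (Fin n) ℝ, R⁻¹ * (R * X) = X := fun X => by
        rw [← Matrix.mul_assoc, nonsing_inv_mul _ hRu, Matrix.one_mul]
      simp only [transpose_add, transpose_mul, Matrix.add_mul, Matrix.mul_add, Matrix.mul_assoc,
        h2, h3, h4]
      abel
    have hPW : (A + B * K)ᵀ * P * (A + B * K) + σ ^ 2 • ((C + D * K)ᵀ * P * (C + D * K))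
        = P - (Q + Kᵀ * S + Sᵀ * K + Kᵀ * R * K) := by
      rw [← sub_eq_zero, ← hric]
      abel
    have h0' : (M 0).PosSemidef := h0 ▸ hpsd0
    have hs := rec_summable h0' hM hP.posSemidef hW hPW P
    have ht := rec_telescope P hs
    rw [h0, hval] at ht
    convert ht using 2 with t
    rw [rec_trace hM, hPW, sub_mul, trace_sub]
    ring
  · rintro K' ⟨P', hP', hW'⟩ M h0 hM
    have h0' : (M 0).PosSemidef := h0 ▸ hpsd0
    have hS := rec_summable h0' hM hP'.posSemidef hW' (by abel)
    have ht := rec_telescope P (hS P)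
    rw [h0, hval] at ht
    have hH : (R + Bᵀ * P * B + σ ^ 2 • (Dᵀ * P * D)).PosDef :=
      (hR.add_posSemidef (psd_conj2 hP.posSemidef B)).add_posSemidef
        (psd_smul (psd_conj2 hP.posSemidef D) σ)
    have hHu := (isUnit_iff_isUnit_det _).1 hH.isUnit
    have hHK : (R + Bᵀ * P * B + σ ^ 2 • (Dᵀ * P * D)) * K
        + (Bᵀ * P * A + σ ^ 2 • (Dᵀ * P * C) + S) = 0 := by
      rw [hK, Matrix.neg_mul, Matrix.mul_neg, ← Matrix.mul_assoc, mul_nonsing_inv _ hHu,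
        Matrix.one_mul, neg_add_cancel]
    obtain ⟨E, rfl⟩ : ∃ E, K' = K + E := ⟨K' - K, by abel⟩
    have hkey : (Q + (K + E)ᵀ * S + Sᵀ * (K + E) + (K + E)ᵀ * R * (K + E))
        - (P - ((A + B * (K + E))ᵀ * P * (A + B * (K + E))
          + σ ^ 2 • ((C + D * (K + E))ᵀ * P * (C + D * (K + E)))))
        = Eᵀ * (R + Bᵀ * P * B + σ ^ 2 • (Dᵀ * P * D)) * E := by
      have e : (Q + (K + E)ᵀ * S + Sᵀ * (K + E) + (K + E)ᵀ * R * (K + E))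
        - (P - ((A + B * (K + E))ᵀ * P * (A + B * (K + E))
          + σ ^ 2 • ((C + D * (K + E))ᵀ * P * (C + D * (K + E)))))
        = Eᵀ * (R + Bᵀ * P * B + σ ^ 2 • (Dᵀ * P * D)) * E
          + ((A + B * K)ᵀ * P * (A + B * K) +
              σ ^ 2 • ((C + D * K)ᵀ * P * (C + D * K)) +
              Kᵀ * R * K + Kᵀ * S + Sᵀ * K + Q - P)
          + Eᵀ * ((R + Bᵀ * P * B + σ ^ 2 • (Dᵀ * P * D)) * K
            + (Bᵀ * P * A + σ ^ 2 • (Dᵀ * P * C) + S))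
          + ((R + Bᵀ * P * B + σ ^ 2 • (Dᵀ * P * D)) * K
            + (Bᵀ * P * A + σ ^ 2 • (Dᵀ * P * C) + S))ᵀ * E := by
        simp only [transpose_add, transpose_mul, transpose_smul, transpose_transpose,
          Matrix.add_mul, Matrix.mul_add, Matrix.mul_assoc, Matrix.smul_mul, Matrix.mul_smul,
          smul_add, hPs, hRs]
        abel
      rw [e, hric, hHK]
      simp
    rw [← ht.tsum_eq]
    refine ht.summable.tsum_le_tsum (fun t => ?_) (hS _)
    have h := psd_trace (psd_conj2 hH.posSemidef E) (rec_psd h0' hM t)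
    rw [← hkey, sub_mul, sub_mul, trace_sub, trace_sub, ← rec_trace hM] at h
    linarith
end

section
/- Let n, m be positive integers, A, C ∈ ℝ^{n×n}, B, D ∈ ℝ^{n×m}, σ > 0, Q ∈ ℝ^{n×n} symmetric, S ∈ ℝ^{m×n}, R ∈ ℝ^{m×m} symmetric, and K ∈ ℝ^{m×n}; write F = A + BK, G = C + DK and Q_K = Q + Kᵀ S + Sᵀ K + Kᵀ R K. If a symmetric matrix P satisfies the Lyapunov recursion Fᵀ P F + σ² Gᵀ P G + Q_K − P = 0, then for every ξ ∈ ℝⁿ and every natural number l, the policy-evaluation identity ξᵀ P ξ − trace(P M_{l+1}) = ∑_{t=0}^{l} trace(Q_K M_t) holds, where M₀ = ξ ξᵀ and M_{t+1} = F M_t Fᵀ + σ² G M_t Gᵀ. -/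
open Matrix Filter

theorem policy_evaluation_identity_of_lyapunov
    (n m : ℕ) (hn : 0 < n) (hm : 0 < m)
    (A C : Matrix (Fin n) (Fin n) ℝ) (B D : Matrix (Fin n) (Fin m) ℝ)
    (σ : ℝ) (hσ : 0 < σ)
    (Q : Matrix (Fin n) (Fin n) ℝ) (hQ : Q.IsSymm)
    (S : Matrix (Fin m) (Fin n) ℝ)
    (R : Matrix (Fin m) (Fin m) ℝ) (hR : R.IsSymm)
    (K : Matrix (Fin m) (Fin n) ℝ)
    (F G : Matrix (Fin n) (Fin n) ℝ)
    (hF : F = A + B * K) (hG : G = C + D * K)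
    (P : Matrix (Fin n) (Fin n) ℝ) (hP : P.IsSymm)
    (hlyap : Fᵀ * P * F + σ ^ 2 • (Gᵀ * P * G) +
        (Q + Kᵀ * S + Sᵀ * K + Kᵀ * R * K) - P = 0) :
    ∀ ξ : Fin n → ℝ, ∀ l : ℕ, ∀ M : ℕ → Matrix (Fin n) (Fin n) ℝ,
      M 0 = vecMulVec ξ ξ →
      (∀ t, M (t + 1) = F * M t * Fᵀ + σ ^ 2 • (G * M t * Gᵀ)) →
      ξ ⬝ᵥ P *ᵥ ξ - (P * M (l + 1)).trace =
        ∑ t ∈ Finset.range (l + 1),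
          ((Q + Kᵀ * S + Sᵀ * K + Kᵀ * R * K) * M t).trace := by
  intro ξ l M h0 hM
  generalize (Q + Kᵀ * S + Sᵀ * K + Kᵀ * R * K) = W at hlyap ⊢
  have key : ∀ (H N : Matrix (Fin n) (Fin n) ℝ),
      (P * (H * N * Hᵀ)).trace = (Hᵀ * P * H * N).trace := by
    intro H N
    rw [← Matrix.mul_assoc, Matrix.trace_mul_comm]
    simp only [Matrix.mul_assoc]
  have step : ∀ t, (W * M t).trace = (P * M t).trace - (P * M (t + 1)).trace := by
    intro t
    have hh := congrArg (fun X => (X * M t).trace) hlyap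
    simp only [Matrix.sub_mul, Matrix.add_mul, Matrix.trace_sub, Matrix.trace_add,
      Matrix.smul_mul, Matrix.trace_smul, Matrix.zero_mul, Matrix.trace_zero] at hh
    rw [hM t, Matrix.mul_add, Matrix.mul_smul, Matrix.trace_add, Matrix.trace_smul, key, key]
    linarith
  have h1 : ξ ⬝ᵥ P *ᵥ ξ = (P * M 0).trace := by
    rw [h0, Matrix.mul_vecMulVec, Matrix.trace_vecMulVec, dotProduct_comm]
  rw [h1, Finset.sum_congr rfl (fun t _ => step t),
    Finset.sum_range_sub' (fun t => (P * M t).trace)]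
end

section
/- Let n, m be positive integers, A, C ∈ ℝ^{n×n}, B, D ∈ ℝ^{n×m}, σ > 0, Q ∈ ℝ^{n×n} symmetric, S ∈ ℝ^{m×n}, R ∈ ℝ^{m×m} symmetric positive definite. Let K_old ∈ ℝ^{m×n}, let P be a symmetric positive semidefinite matrix satisfying (A+BK_old)ᵀ P (A+BK_old) + σ² (C+DK_old)ᵀ P (C+DK_old) + K_oldᵀ R K_old + K_oldᵀ S + Sᵀ K_old + Q − P = 0, and set K_new = −(R + Bᵀ P B + σ² Dᵀ P D)⁻¹ (Bᵀ P A + σ² Dᵀ P C + S). Then (A+BK_new)ᵀ P (A+BK_new) + σ² (C+DK_new)ᵀ P (C+DK_new) − P = −(Q − Sᵀ R⁻¹ S) − (K_new + R⁻¹ S)ᵀ R (K_new + R⁻¹ S) − (K_old − K_new)ᵀ (R + Bᵀ P B + σ² Dᵀ P D)(K_old − K_new). -/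
open Matrix Filter

theorem policy_improvement_key_identity
    (n m : ℕ) (hn : 0 < n) (hm : 0 < m)
    (A C : Matrix (Fin n) (Fin n) ℝ) (B D : Matrix (Fin n) (Fin m) ℝ)
    (σ : ℝ) (hσ : 0 < σ)
    (Q : Matrix (Fin n) (Fin n) ℝ) (hQ : Q.IsSymm)
    (S : Matrix (Fin m) (Fin n) ℝ)
    (R : Matrix (Fin m) (Fin m) ℝ) (hR : R.PosDef)
    (Kold : Matrix (Fin m) (Fin n) ℝ)
    (P : Matrix (Fin n) (Fin n) ℝ) (hP : P.PosSemidef)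
    (hlyap : (A + B * Kold)ᵀ * P * (A + B * Kold) +
        σ ^ 2 • ((C + D * Kold)ᵀ * P * (C + D * Kold)) +
        Koldᵀ * R * Kold + Koldᵀ * S + Sᵀ * Kold + Q - P = 0)
    (Knew : Matrix (Fin m) (Fin n) ℝ)
    (hKnew : Knew = -(R + Bᵀ * P * B + σ ^ 2 • (Dᵀ * P * D))⁻¹ *
        (Bᵀ * P * A + σ ^ 2 • (Dᵀ * P * C) + S)) :
    (A + B * Knew)ᵀ * P * (A + B * Knew) +
      σ ^ 2 • ((C + D * Knew)ᵀ * P * (C + D * Knew)) - P =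
    -(Q - Sᵀ * R⁻¹ * S) -
      (Knew + R⁻¹ * S)ᵀ * R * (Knew + R⁻¹ * S) -
      (Kold - Knew)ᵀ * (R + Bᵀ * P * B + σ ^ 2 • (Dᵀ * P * D)) *
        (Kold - Knew) := by
  have hPt : Pᵀ = P := by simpa [Matrix.IsHermitian] using hP.isHermitian
  have hRt : Rᵀ = R := by simpa [Matrix.IsHermitian] using hR.isHermitian
  have hM : (R + Bᵀ * P * B + σ ^ 2 • (Dᵀ * P * D)).PosDef := by
    have h1 : (Bᵀ * P * B).PosSemidef := by
      simpa using hP.conjTranspose_mul_mul_same B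
    have h2 : (Dᵀ * P * D).PosSemidef := by
      simpa using hP.conjTranspose_mul_mul_same D
    exact (hR.add_posSemidef h1).add_posSemidef (h2.smul (sq_nonneg σ))
  have hMu := (Matrix.isUnit_iff_isUnit_det _).1 hM.isUnit
  have hRu := (Matrix.isUnit_iff_isUnit_det _).1 hR.isUnit
  have h : (R + Bᵀ * P * B + σ ^ 2 • (Dᵀ * P * D)) * Knew +
      (Bᵀ * P * A + σ ^ 2 • (Dᵀ * P * C) + S) = 0 := by
    rw [hKnew, Matrix.neg_mul, Matrix.mul_neg, Matrix.mul_nonsing_inv_cancel_left _ _ hMu]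
    exact neg_add_cancel _
  clear hKnew hM hMu
  have h' := congrArg Matrix.transpose h
  have hc : (Knew + R⁻¹ * S)ᵀ * R * (Knew + R⁻¹ * S) =
      Knewᵀ * R * Knew + Knewᵀ * S + Sᵀ * Knew + Sᵀ * R⁻¹ * S := by
    have a1 : R * (R⁻¹ * S) = S := Matrix.mul_nonsing_inv_cancel_left _ _ hRu
    have a2 : R⁻¹ * (R * Knew) = Knew := Matrix.nonsing_inv_mul_cancel_left _ _ hRu
    simp only [Matrix.transpose_add, Matrix.transpose_mul, Matrix.transpose_nonsing_inv, hRt,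
      Matrix.add_mul, Matrix.mul_add, Matrix.mul_assoc, a1, a2]
    abel
  rw [hc]
  have e1 := congrArg (fun Z => (Knew - Kold)ᵀ * Z) h
  have e2 := congrArg (fun Z => Z * (Knew - Kold)) h'
  clear h h' hc
  simp only [Matrix.transpose_add, Matrix.transpose_sub, Matrix.transpose_mul,
    Matrix.transpose_smul, Matrix.transpose_transpose, Matrix.transpose_zero, hPt, hRt,
    Matrix.add_mul, Matrix.mul_add, Matrix.sub_mul, Matrix.mul_sub, Matrix.smul_mul,
    Matrix.mul_smul, Matrix.mul_assoc, Matrix.mul_zero, Matrix.zero_mul, smul_add, smul_sub]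
    at e1 e2 hlyap ⊢
  linear_combination (norm := module) e1 + e2 + hlyap
end

section
/- Let n, m be positive integers, A, C ∈ ℝ^{n×n}, B, D ∈ ℝ^{n×m}, σ > 0, Q ∈ ℝ^{n×n} symmetric, S ∈ ℝ^{m×n}, R ∈ ℝ^{m×m} symmetric positive definite with Q − Sᵀ R⁻¹ S positive definite. Let K_old ∈ ℝ^{m×n} be a stabilizer, let P be the symmetric positive definite solution of (A+BK_old)ᵀ P (A+BK_old) + σ² (C+DK_old)ᵀ P (C+DK_old) + K_oldᵀ R K_old + K_oldᵀ S + Sᵀ K_old + Q − P = 0, and set K_new = −(R + Bᵀ P B + σ² Dᵀ P D)⁻¹ (Bᵀ P A + σ² Dᵀ P C + S). Then (A+BK_new)ᵀ P (A+BK_new) + σ² (C+DK_new)ᵀ P (C+DK_new) − P is negative definite; in particular K_new is a stabilizer. -/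
open Matrix Filter

theorem policy_improvement_preserves_stability
    (n m : ℕ) (hn : 0 < n) (hm : 0 < m)
    (A C : Matrix (Fin n) (Fin n) ℝ) (B D : Matrix (Fin n) (Fin m) ℝ)
    (σ : ℝ) (hσ : 0 < σ)
    (Q : Matrix (Fin n) (Fin n) ℝ) (hQ : Q.IsSymm)
    (S : Matrix (Fin m) (Fin n) ℝ)
    (R : Matrix (Fin m) (Fin m) ℝ) (hR : R.PosDef)
    (hQS : (Q - Sᵀ * R⁻¹ * S).PosDef)
    (Kold : Matrix (Fin m) (Fin n) ℝ)
    (hKold : IsStabilizer A C B D σ Kold)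
    (P : Matrix (Fin n) (Fin n) ℝ) (hP : P.PosDef)
    (hlyap : (A + B * Kold)ᵀ * P * (A + B * Kold) +
        σ ^ 2 • ((C + D * Kold)ᵀ * P * (C + D * Kold)) +
        Koldᵀ * R * Kold + Koldᵀ * S + Sᵀ * Kold + Q - P = 0)
    (Knew : Matrix (Fin m) (Fin n) ℝ)
    (hKnew : Knew = -(R + Bᵀ * P * B + σ ^ 2 • (Dᵀ * P * D))⁻¹ *
        (Bᵀ * P * A + σ ^ 2 • (Dᵀ * P * C) + S)) :
    (-((A + B * Knew)ᵀ * P * (A + B * Knew) +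
        σ ^ 2 • ((C + D * Knew)ᵀ * P * (C + D * Knew)) - P)).PosDef ∧
    IsStabilizer A C B D σ Knew := by
  have hPt : Pᵀ = P := by simpa using hP.isHermitian.eq
  have hRt : Rᵀ = R := by simpa using hR.isHermitian.eq
  have hRu : IsUnit R.det := (Matrix.isUnit_iff_isUnit_det R).1 hR.isUnit
  have hRit : (R⁻¹)ᵀ = R⁻¹ := by rw [Matrix.transpose_nonsing_inv, hRt]
  have hW : (R + Bᵀ * P * B + σ ^ 2 • (Dᵀ * P * D)).PosDef := by
    have h1 := hP.posSemidef.conjTranspose_mul_mul_same B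
    have h2 := (hP.posSemidef.conjTranspose_mul_mul_same D).smul (sq_nonneg σ)
    simp only [Matrix.conjTranspose_eq_transpose_of_trivial] at h1 h2
    exact (hR.add_posSemidef h1).add_posSemidef h2
  have hWu := (Matrix.isUnit_iff_isUnit_det _).1 hW.isUnit
  have hE : (R + Bᵀ * P * B + σ ^ 2 • (Dᵀ * P * D)) * Knew +
      (Bᵀ * P * A + σ ^ 2 • (Dᵀ * P * C) + S) = 0 := by
    rw [hKnew, Matrix.neg_mul, Matrix.mul_neg, Matrix.mul_nonsing_inv_cancel_left _ _ hWu]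
    abel
  clear hKnew
  have hEt := congrArg Matrix.transpose hE
  have h1 : (Kold - Knew)ᵀ * ((R + Bᵀ * P * B + σ ^ 2 • (Dᵀ * P * D)) * Knew +
      (Bᵀ * P * A + σ ^ 2 • (Dᵀ * P * C) + S)) = 0 := by rw [hE, Matrix.mul_zero]
  have h2 : ((R + Bᵀ * P * B + σ ^ 2 • (Dᵀ * P * D)) * Knew +
      (Bᵀ * P * A + σ ^ 2 • (Dᵀ * P * C) + S))ᵀ * (Kold - Knew) = 0 := by
    rw [hE, Matrix.transpose_zero, Matrix.zero_mul]
  have key : -((A + B * Knew)ᵀ * P * (A + B * Knew) +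
        σ ^ 2 • ((C + D * Knew)ᵀ * P * (C + D * Knew)) - P) =
      (Q - Sᵀ * R⁻¹ * S) + (Knew + R⁻¹ * S)ᵀ * R * (Knew + R⁻¹ * S) +
      (Kold - Knew)ᵀ * (R + Bᵀ * P * B + σ ^ 2 • (Dᵀ * P * D)) * (Kold - Knew) := by
    have h3 : (Knew + R⁻¹ * S)ᵀ * R * (Knew + R⁻¹ * S) =
        Knewᵀ * R * Knew + Knewᵀ * S + Sᵀ * Knew + Sᵀ * R⁻¹ * S := by
      simp only [Matrix.transpose_add, Matrix.transpose_mul, hRit, Matrix.add_mul,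
        Matrix.mul_add, Matrix.mul_assoc, Matrix.mul_nonsing_inv_cancel_left _ _ hRu,
        Matrix.nonsing_inv_mul_cancel_left _ _ hRu]
      abel
    rw [h3, ← sub_eq_zero]
    refine Eq.trans ?_ (show -((A + B * Kold)ᵀ * P * (A + B * Kold) +
        σ ^ 2 • ((C + D * Kold)ᵀ * P * (C + D * Kold)) +
        Koldᵀ * R * Kold + Koldᵀ * S + Sᵀ * Kold + Q - P) + 
        ((Kold - Knew)ᵀ * ((R + Bᵀ * P * B + σ ^ 2 • (Dᵀ * P * D)) * Knew +
      (Bᵀ * P * A + σ ^ 2 • (Dᵀ * P * C) + S))) + 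
        ((R + Bᵀ * P * B + σ ^ 2 • (Dᵀ * P * D)) * Knew +
      (Bᵀ * P * A + σ ^ 2 • (Dᵀ * P * C) + S))ᵀ * (Kold - Knew) = 0 by
        rw [hlyap, h1, h2]; simp)
    simp only [Matrix.transpose_add, Matrix.transpose_sub, Matrix.transpose_mul,
      Matrix.transpose_smul, Matrix.transpose_transpose, hPt, hRt, Matrix.add_mul,
      Matrix.mul_add, Matrix.sub_mul, Matrix.mul_sub, Matrix.smul_mul, Matrix.mul_smul,
      Matrix.mul_assoc, smul_add, smul_sub]
    abel
  have hmain : (-((A + B * Knew)ᵀ * P * (A + B * Knew) +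
        σ ^ 2 • ((C + D * Knew)ᵀ * P * (C + D * Knew)) - P)).PosDef := by
    rw [key]
    have g1 := hR.posSemidef.conjTranspose_mul_mul_same (Knew + R⁻¹ * S)
    have g2 := hW.posSemidef.conjTranspose_mul_mul_same (Kold - Knew)
    rw [Matrix.conjTranspose_eq_transpose_of_trivial] at g1 g2
    exact (hQS.add_posSemidef g1).add_posSemidef g2
  exact ⟨hmain, P, hP, hmain⟩
end

section
/- Let n, m be positive integers, A, C ∈ ℝ^{n×n}, B, D ∈ ℝ^{n×m}, σ > 0, Q ∈ ℝ^{n×n} symmetric, S ∈ ℝ^{m×n}, R ∈ ℝ^{m×m} symmetric positive definite with Q − Sᵀ R⁻¹ S positive definite. Suppose K : ℕ → ℝ^{m×n} and P : ℕ → ℝ^{n×n} are sequences such that K(0) is a stabilizer and, for every i, P(i+1) is symmetric and satisfies (A+BK(i))ᵀ P(i+1) (A+BK(i)) + σ² (C+DK(i))ᵀ P(i+1) (C+DK(i)) + K(i)ᵀ R K(i) + K(i)ᵀ S + Sᵀ K(i) + Q − P(i+1) = 0, and K(i+1) = −(R + Bᵀ P(i+1) B + σ² Dᵀ P(i+1)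 D)⁻¹ (Bᵀ P(i+1) A + σ² Dᵀ P(i+1) C + S). Then for every i ≥ 0, K(i) is a stabilizer and P(i+1) is positive definite. -/
open Matrix Filter

theorem aux_compact {n : ℕ} (P X : Matrix (Fin n) (Fin n) ℝ) (hX : X.PosDef)
    (hP : P.IsSymm) (hnot : ¬ P.PosDef) :
    ∃ t : ℝ, 0 ≤ t ∧ (P + t • X).PosSemidef ∧ ¬ (P + t • X).PosDef := by
  have hPH : P.IsHermitian := by
    rw [Matrix.IsHermitian, Matrix.conjTranspose_eq_transpose_of_trivial]; exact hP
  have hXpos : ∀ x : Fin n → ℝ, x ≠ 0 → 0 < x ⬝ᵥ (X *ᵥ x) := by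
    intro x hx
    simpa using hX.dotProduct_mulVec_pos hx
  have hex : ∃ y : Fin n → ℝ, y ≠ 0 ∧ y ⬝ᵥ (P *ᵥ y) ≤ 0 := by
    by_contra hcon
    push Not at hcon
    exact hnot (Matrix.PosDef.of_dotProduct_mulVec_pos hPH (fun x hx => by simpa using hcon x hx))
  obtain ⟨y, hy, hyP⟩ := hex
  let f : (Fin n → ℝ) → ℝ := fun x => (x ⬝ᵥ (P *ᵥ x)) / (x ⬝ᵥ (X *ᵥ x))
  have hne : ∀ x ∈ Metric.sphere (0 : Fin n → ℝ) 1, x ≠ 0 := by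
    intro x hx h0
    simp [h0] at hx
  have hscale : ∀ x : Fin n → ℝ, x ≠ 0 →
      (‖x‖⁻¹ • x) ∈ Metric.sphere (0 : Fin n → ℝ) 1 ∧ f (‖x‖⁻¹ • x) = f x := by
    intro x hx
    have hn : ‖x‖ ≠ 0 := norm_ne_zero_iff.mpr hx
    refine ⟨by simp [norm_smul, hn], ?_⟩
    have h1 := (hXpos x hx).ne'
    simp only [f, Matrix.mulVec_smul, dotProduct_smul, smul_dotProduct, smul_eq_mul]
    field_simp
  have hcont : ContinuousOn f (Metric.sphere (0 : Fin n → ℝ) 1) := by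
    apply ContinuousOn.div
    · fun_prop
    · fun_prop
    · intro x hx
      exact (hXpos x (hne x hx)).ne'
  obtain ⟨z, hz, hmin⟩ := (isCompact_sphere (0 : Fin n → ℝ) 1).exists_isMinOn
    ⟨_, (hscale y hy).1⟩ hcont
  have hall : ∀ x : Fin n → ℝ, x ≠ 0 → f z ≤ f x := by
    intro x hx
    rw [← (hscale x hx).2]
    exact hmin (hscale x hx).1
  have hz0 := hne z hz
  have hev : ∀ x : Fin n → ℝ, x ⬝ᵥ ((P + (-f z) • X) *ᵥ x)
      = x ⬝ᵥ (P *ᵥ x) - f z * (x ⬝ᵥ (X *ᵥ x)) := by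
    intro x
    simp only [Matrix.add_mulVec, Matrix.smul_mulVec, dotProduct_add, dotProduct_smul, smul_eq_mul]
    ring
  have hH : (P + (-f z) • X).IsHermitian := by
    refine hPH.add ?_
    rw [Matrix.IsHermitian, Matrix.conjTranspose_smul, hX.isHermitian.eq]
    simp
  refine ⟨-f z, ?_, ?_, ?_⟩
  · have h1 := hall y hy
    have h2 : f y ≤ 0 := div_nonpos_of_nonpos_of_nonneg hyP (hXpos y hy).le
    linarith
  · refine Matrix.PosSemidef.of_dotProduct_mulVec_nonneg hH (fun x => ?_)
    rw [star_trivial, hev]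
    by_cases hx : x = 0
    · simp [hx]
    · have h1 := hall x hx
      have h2 := (le_div_iff₀ (hXpos x hx)).1 h1
      linarith
  · intro hpd
    have h1 := hpd.dotProduct_mulVec_pos hz0
    rw [star_trivial, hev] at h1
    have h2 : f z * (z ⬝ᵥ (X *ᵥ z)) = z ⬝ᵥ (P *ᵥ z) := div_mul_cancel₀ _ (hXpos z hz0).ne'
    linarith

theorem aux_psd {k n : ℕ} (P : Matrix (Fin n) (Fin n) ℝ) (F : Matrix (Fin n) (Fin k) ℝ)
    (hP : P.PosSemidef) : (Fᵀ * P * F).PosSemidef := by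
  simpa [Matrix.conjTranspose_eq_transpose_of_trivial] using hP.conjTranspose_mul_mul_same F

theorem aux_lyap {n : ℕ} (F G P X : Matrix (Fin n) (Fin n) ℝ) (σ : ℝ)
    (hX : X.PosDef) (hXL : (-(Fᵀ * X * F + σ ^ 2 • (Gᵀ * X * G) - X)).PosDef)
    (hP : P.IsSymm) (hPL : (P - (Fᵀ * P * F + σ ^ 2 • (Gᵀ * P * G))).PosDef) :
    P.PosDef := by
  by_contra hnot
  obtain ⟨t, ht, hpsd, hn⟩ := aux_compact P X hX hP hnot
  apply hn
  have h1 := aux_psd _ F hpsd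
  have h2 := (aux_psd _ G hpsd).smul (sq_nonneg σ)
  have h3 := hXL.posSemidef.smul ht
  have h4 := hPL.add_posSemidef ((h1.add h2).add h3)
  convert h4 using 1
  simp only [Matrix.mul_add, Matrix.add_mul, Matrix.mul_smul, Matrix.smul_mul]
  module

theorem aux_cost {n m : ℕ} (Q : Matrix (Fin n) (Fin n) ℝ) (S : Matrix (Fin m) (Fin n) ℝ)
    (R : Matrix (Fin m) (Fin m) ℝ) (hR : R.PosDef)
    (hQS : (Q - Sᵀ * R⁻¹ * S).PosDef) (K : Matrix (Fin m) (Fin n) ℝ) :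
    (Kᵀ * R * K + Kᵀ * S + Sᵀ * K + Q).PosDef := by
  have h1 := aux_psd R (K + R⁻¹ * S) hR.posSemidef
  have h2 := hQS.add_posSemidef h1
  have hu : IsUnit R.det := (Matrix.isUnit_iff_isUnit_det R).1 hR.isUnit
  have hRt : Rᵀ = R := by
    rw [← Matrix.conjTranspose_eq_transpose_of_trivial]; exact hR.isHermitian.eq
  have e1 : R * (R⁻¹ * S) = S := Matrix.mul_nonsing_inv_cancel_left _ _ hu
  have e2 : R⁻¹ * (R * K) = K := Matrix.nonsing_inv_mul_cancel_left _ _ hu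
  convert h2 using 1
  simp only [Matrix.transpose_add, Matrix.transpose_mul, Matrix.transpose_nonsing_inv, hRt,
    Matrix.mul_add, Matrix.add_mul, Matrix.mul_assoc, e1, e2]
  abel

theorem aux_improve {n m : ℕ} (A C : Matrix (Fin n) (Fin n) ℝ) (B D : Matrix (Fin n) (Fin m) ℝ)
    (σ : ℝ) (Q : Matrix (Fin n) (Fin n) ℝ) (S : Matrix (Fin m) (Fin n) ℝ)
    (R : Matrix (Fin m) (Fin m) ℝ) (hR : Rᵀ = R)
    (K E : Matrix (Fin m) (Fin n) ℝ) (P : Matrix (Fin n) (Fin n) ℝ) (hP : Pᵀ = P)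
    (h : (R + Bᵀ * P * B + σ ^ 2 • (Dᵀ * P * D)) * K +
          (Bᵀ * P * A + σ ^ 2 • (Dᵀ * P * C) + S) = 0) :
    (A + B * (K + E))ᵀ * P * (A + B * (K + E)) +
        σ ^ 2 • ((C + D * (K + E))ᵀ * P * (C + D * (K + E))) +
        ((K + E)ᵀ * R * (K + E) + (K + E)ᵀ * S + Sᵀ * (K + E) + Q) =
    (A + B * K)ᵀ * P * (A + B * K) +
        σ ^ 2 • ((C + D * K)ᵀ * P * (C + D * K)) +
        (Kᵀ * R * K + Kᵀ * S + Sᵀ * K + Q) +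
      Eᵀ * (R + Bᵀ * P * B + σ ^ 2 • (Dᵀ * P * D)) * E := by
  have h1 := congrArg (fun Z => Eᵀ * Z) h
  have h2 := congrArg (fun Z => Zᵀ * E) h
  have h3 := congrArg₂ (· + ·) h1 h2
  simp only [Matrix.transpose_add, Matrix.transpose_mul, Matrix.transpose_smul, hR, hP,
    Matrix.transpose_transpose, Matrix.transpose_zero, Matrix.zero_mul, Matrix.mul_zero,
    Matrix.mul_add, Matrix.add_mul, Matrix.mul_assoc, Matrix.mul_smul, Matrix.smul_mul,
    smul_add, add_zero] at h3 ⊢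
  rw [← sub_eq_zero]
  rw [← h3]
  module

theorem policy_iteration_stepwise_stable
    (n m : ℕ) (hn : 0 < n) (hm : 0 < m)
    (A C : Matrix (Fin n) (Fin n) ℝ) (B D : Matrix (Fin n) (Fin m) ℝ)
    (σ : ℝ) (hσ : 0 < σ)
    (Q : Matrix (Fin n) (Fin n) ℝ) (hQ : Q.IsSymm)
    (S : Matrix (Fin m) (Fin n) ℝ)
    (R : Matrix (Fin m) (Fin m) ℝ) (hR : R.PosDef)
    (hQS : (Q - Sᵀ * R⁻¹ * S).PosDef)
    (K : ℕ → Matrix (Fin m) (Fin n) ℝ)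
    (P : ℕ → Matrix (Fin n) (Fin n) ℝ)
    (hK0 : IsStabilizer A C B D σ (K 0))
    (hPsymm : ∀ i, (P (i + 1)).IsSymm)
    (hlyap : ∀ i, (A + B * K i)ᵀ * P (i + 1) * (A + B * K i) +
        σ ^ 2 • ((C + D * K i)ᵀ * P (i + 1) * (C + D * K i)) +
        (K i)ᵀ * R * K i + (K i)ᵀ * S + Sᵀ * K i + Q - P (i + 1) = 0)
    (hupd : ∀ i, K (i + 1) =
        -(R + Bᵀ * P (i + 1) * B + σ ^ 2 • (Dᵀ * P (i + 1) * D))⁻¹ *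
          (Bᵀ * P (i + 1) * A + σ ^ 2 • (Dᵀ * P (i + 1) * C) + S)) :
    ∀ i, IsStabilizer A C B D σ (K i) ∧ (P (i + 1)).PosDef := by
  have hRt : Rᵀ = R := by
    rw [← Matrix.conjTranspose_eq_transpose_of_trivial]; exact hR.isHermitian.eq
  have hpd : ∀ i, IsStabilizer A C B D σ (K i) → (P (i + 1)).PosDef := by
    rintro i ⟨X, hX, hXL⟩
    refine aux_lyap (A + B * K i) (C + D * K i) _ X σ hX hXL (hPsymm i) ?_
    convert aux_cost Q S R hR hQS (K i) using 1
    rw [← sub_eq_zero, ← neg_eq_zero, ← hlyap i]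
    abel
  have hst : ∀ i, IsStabilizer A C B D σ (K i) := by
    intro i
    induction i with
    | zero => exact hK0
    | succ i ih =>
      have hp := hpd i ih
      have hM : (R + Bᵀ * P (i + 1) * B + σ ^ 2 • (Dᵀ * P (i + 1) * D)).PosDef :=
        (hR.add_posSemidef (aux_psd _ B hp.posSemidef)).add_posSemidef
          ((aux_psd _ D hp.posSemidef).smul (sq_nonneg σ))
      have hu := (Matrix.isUnit_iff_isUnit_det _).1 hM.isUnit
      have hK : (R + Bᵀ * P (i + 1) * B + σ ^ 2 • (Dᵀ * P (i + 1) * D)) * K (i + 1) +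
          (Bᵀ * P (i + 1) * A + σ ^ 2 • (Dᵀ * P (i + 1) * C) + S) = 0 := by
        rw [hupd i, Matrix.neg_mul, Matrix.mul_neg, Matrix.mul_nonsing_inv_cancel_left _ _ hu]
        exact neg_add_cancel _
      have key := aux_improve A C B D σ Q S R hRt (K (i + 1)) (K i - K (i + 1)) (P (i + 1))
        (hPsymm i) hK
      rw [add_sub_cancel] at key
      have hc := (aux_cost Q S R hR hQS (K (i + 1))).add_posSemidef
        (aux_psd _ (K i - K (i + 1)) hM.posSemidef)
      refine ⟨P (i + 1), hp, ?_⟩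
      convert hc using 1
      have hl := hlyap i
      rw [sub_eq_zero] at hl
      rw [neg_sub, sub_eq_iff_eq_add]
      refine hl.symm.trans ?_
      rw [← sub_eq_zero] at key ⊢
      rw [← key]
      abel
  exact fun i => ⟨hst i, hpd i (hst i)⟩
end

section
/- Let n, m be positive integers, A, C ∈ ℝ^{n×n}, B, D ∈ ℝ^{n×m}, σ > 0, Q ∈ ℝ^{n×n} symmetric, S ∈ ℝ^{m×n}, R ∈ ℝ^{m×m} symmetric. Let K_prev, K ∈ ℝ^{m×n}, and let P_prev and P_next be symmetric matrices satisfying (A+BK_prev)ᵀ P_prev (A+BK_prev) + σ² (C+DK_prev)ᵀ P_prev (C+DK_prev) + K_prevᵀ R K_prev + K_prevᵀ S + Sᵀ K_prev + Q − P_prev = 0 and (A+BK)ᵀ P_next (A+BK) + σ² (C+DK)ᵀ P_next (C+DK) + Kᵀ R K + Kᵀ S + Sᵀ K + Q − P_next = 0, where K = −(R + Bᵀ P_prev B + σ² Dᵀ P_prev D)⁻¹ (Bᵀ P_prev A + σ² Dᵀ P_prev C + S) and R + Bᵀ P_prev B + σ² Dᵀ P_prev D is invertible. Then the difference P̂ =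 P_prev − P_next satisfies the Lyapunov equation P̂ = (A+BK)ᵀ P̂ (A+BK) + σ² (C+DK)ᵀ P̂ (C+DK) + (K_prev − K)ᵀ (R + Bᵀ P_prev B + σ² Dᵀ P_prev D)(K_prev − K). -/
open Matrix Filter

theorem difference_lyapunov_identity
    (n m : ℕ) (hn : 0 < n) (hm : 0 < m)
    (A C : Matrix (Fin n) (Fin n) ℝ) (B D : Matrix (Fin n) (Fin m) ℝ)
    (σ : ℝ) (hσ : 0 < σ)
    (Q : Matrix (Fin n) (Fin n) ℝ) (hQ : Q.IsSymm)
    (S : Matrix (Fin m) (Fin n) ℝ)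
    (R : Matrix (Fin m) (Fin m) ℝ) (hR : R.IsSymm)
    (Kprev K : Matrix (Fin m) (Fin n) ℝ)
    (Pprev Pnext : Matrix (Fin n) (Fin n) ℝ)
    (hPprev : Pprev.IsSymm) (hPnext : Pnext.IsSymm)
    (hinv : IsUnit (R + Bᵀ * Pprev * B + σ ^ 2 • (Dᵀ * Pprev * D)))
    (hK : K = -(R + Bᵀ * Pprev * B + σ ^ 2 • (Dᵀ * Pprev * D))⁻¹ *
        (Bᵀ * Pprev * A + σ ^ 2 • (Dᵀ * Pprev * C) + S))
    (hlyap_prev : (A + B * Kprev)ᵀ * Pprev * (A + B * Kprev) +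
        σ ^ 2 • ((C + D * Kprev)ᵀ * Pprev * (C + D * Kprev)) +
        Kprevᵀ * R * Kprev + Kprevᵀ * S + Sᵀ * Kprev + Q - Pprev = 0)
    (hlyap_next : (A + B * K)ᵀ * Pnext * (A + B * K) +
        σ ^ 2 • ((C + D * K)ᵀ * Pnext * (C + D * K)) +
        Kᵀ * R * K + Kᵀ * S + Sᵀ * K + Q - Pnext = 0) :
    Pprev - Pnext =
      (A + B * K)ᵀ * (Pprev - Pnext) * (A + B * K) +
      σ ^ 2 • ((C + D * K)ᵀ * (Pprev - Pnext) * (C + D * K)) +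
      (Kprev - K)ᵀ * (R + Bᵀ * Pprev * B + σ ^ 2 • (Dᵀ * Pprev * D)) *
        (Kprev - K) := by
  have hG : (R + Bᵀ * Pprev * B + σ ^ 2 • (Dᵀ * Pprev * D)) * K +
      (Bᵀ * Pprev * A + σ ^ 2 • (Dᵀ * Pprev * C) + S) = 0 := by
    rw [hK, Matrix.neg_mul, Matrix.mul_neg, ← Matrix.mul_assoc,
      Matrix.mul_nonsing_inv _ ((Matrix.isUnit_iff_isUnit_det _).1 hinv), Matrix.one_mul]
    abel
  have hGt : Kᵀ * (R + Bᵀ * Pprev * B + σ ^ 2 • (Dᵀ * Pprev * D)) +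
      (Aᵀ * Pprev * B + σ ^ 2 • (Cᵀ * Pprev * D) + Sᵀ) = 0 := by
    have h := congrArg Matrix.transpose hG
    simpa [Matrix.transpose_add, Matrix.transpose_mul, Matrix.transpose_smul, hR.eq, hPprev.eq,
      Matrix.mul_assoc] using h
  clear hK
  have h1 := congrArg (fun X => (Kprev - K)ᵀ * X) hG
  have h2 := congrArg (fun X => X * (Kprev - K)) hGt
  clear hG hGt
  rw [← sub_eq_zero]
  have key : ∀ a b c d g : Matrix (Fin n) (Fin n) ℝ, a = 0 → b = 0 → c = 0 → d = 0 →
      g = b - a + c + d → g = 0 := by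
    rintro a b c d g rfl rfl rfl rfl h
    simpa using h
  simp only [Matrix.mul_zero, Matrix.zero_mul] at h1 h2
  refine key _ _ _ _ _ hlyap_prev hlyap_next h1 h2 ?_
  simp only [Matrix.transpose_add, Matrix.transpose_sub, Matrix.transpose_mul, Matrix.mul_add,
    Matrix.add_mul, Matrix.mul_sub, Matrix.sub_mul, Matrix.mul_smul, Matrix.smul_mul,
    smul_add, smul_sub, Matrix.mul_assoc]
  abel
end

section
/- Let n, m be positive integers, A, C ∈ ℝ^{n×n}, B, D ∈ ℝ^{n×m}, σ > 0, Q ∈ ℝ^{n×n} symmetric, S ∈ ℝ^{m×n}, R ∈ ℝ^{m×m} symmetric positive definite with Q − Sᵀ R⁻¹ S positive definite. Suppose K : ℕ → ℝ^{m×n} and P : ℕ → ℝ^{n×n} are sequences such that K(0) is a stabilizer and, for every i, P(i+1) is symmetric and satisfies (A+BK(i))ᵀ P(i+1) (A+BK(i)) + σ² (C+DK(i))ᵀ P(i+1) (C+DK(i)) + K(i)ᵀ R K(i) + K(i)ᵀ S + Sᵀ K(i) + Q − P(i+1) = 0, and K(i+1) = −(R + Bᵀ P(i+1) B + σ² Dᵀ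 P(i+1) D)⁻¹ (Bᵀ P(i+1) A + σ² Dᵀ P(i+1) C + S). Then for every i ≥ 1, P(i) − P(i+1) is positive semidefinite; i.e. the sequence (P(i))_{i≥1} is monotonically nonincreasing in the Loewner order. -/
open Matrix Filter

def lyapOp {n : ℕ} (F G : Matrix (Fin n) (Fin n) ℝ) (σ : ℝ) (X : Matrix (Fin n) (Fin n) ℝ) :
    Matrix (Fin n) (Fin n) ℝ := Fᵀ * X * F + σ ^ 2 • (Gᵀ * X * G)

lemma lyapOp_psd {n : ℕ} (F G : Matrix (Fin n) (Fin n) ℝ) (σ : ℝ)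
    {X : Matrix (Fin n) (Fin n) ℝ} (hX : X.PosSemidef) : (lyapOp F G σ X).PosSemidef := by
  have h1 := hX.conjTranspose_mul_mul_same F
  have h2 := hX.conjTranspose_mul_mul_same G
  rw [conjTranspose_eq_transpose_of_trivial] at h1 h2
  exact h1.add (h2.smul (sq_nonneg σ))

lemma lyapOp_sub {n : ℕ} (F G : Matrix (Fin n) (Fin n) ℝ) (σ : ℝ)
    (X Y : Matrix (Fin n) (Fin n) ℝ) :
    lyapOp F G σ (X - Y) = lyapOp F G σ X - lyapOp F G σ Y := by
  simp only [lyapOp, mul_sub, sub_mul, smul_sub]; abel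

lemma lyapOp_smul {n : ℕ} (F G : Matrix (Fin n) (Fin n) ℝ) (σ t : ℝ)
    (X : Matrix (Fin n) (Fin n) ℝ) :
    lyapOp F G σ (t • X) = t • lyapOp F G σ X := by
  simp only [lyapOp, Matrix.mul_smul, Matrix.smul_mul, smul_add, smul_comm t]

lemma lyap_key {n : ℕ} (F G : Matrix (Fin n) (Fin n) ℝ) (σ : ℝ)
    {T X : Matrix (Fin n) (Fin n) ℝ} (hT : T.PosDef) (hTL : (T - lyapOp F G σ T).PosDef)
    (hXs : X.IsSymm) (hX : (X - lyapOp F G σ X).PosSemidef) : X.PosSemidef := by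
  have hXh : X.IsHermitian := by
    rw [IsHermitian, conjTranspose_eq_transpose_of_trivial]; exact hXs
  by_contra hcon
  have hex : ∃ x : Fin n → ℝ, x ⬝ᵥ X *ᵥ x < 0 := by
    by_contra h
    push Not at h
    exact hcon (.of_dotProduct_mulVec_nonneg hXh (by simpa using h))
  obtain ⟨x0, hx0⟩ := hex
  have hTpos : ∀ x : Fin n → ℝ, x ≠ 0 → 0 < x ⬝ᵥ T *ᵥ x := fun x hx => by
    simpa using hT.dotProduct_mulVec_pos hx
  have hx0' : x0 ≠ 0 := by rintro rfl; simp at hx0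
  let q : (Fin n → ℝ) → ℝ := fun x => (x ⬝ᵥ X *ᵥ x) / (x ⬝ᵥ T *ᵥ x)
  have hqs : ∀ (c : ℝ) (x : Fin n → ℝ), c ≠ 0 → q (c • x) = q x := by
    intro c x hc
    simp only [q, mulVec_smul, smul_dotProduct, dotProduct_smul, smul_eq_mul]
    rw [mul_div_mul_left _ _ hc, mul_div_mul_left _ _ hc]
  have hne : ∀ x ∈ Metric.sphere (0 : Fin n → ℝ) 1, x ≠ 0 := by
    rintro x hx rfl; simp at hx
  have hnorm : ∀ x : Fin n → ℝ, x ≠ 0 → ‖x‖⁻¹ • x ∈ Metric.sphere (0 : Fin n → ℝ) 1 := by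
    intro x hx
    simp [norm_smul, inv_mul_cancel₀ (norm_ne_zero_iff.2 hx)]
  have hqc : ContinuousOn q (Metric.sphere (0 : Fin n → ℝ) 1) := by
    apply ContinuousOn.div
    · exact (Continuous.dotProduct continuous_id
        (Continuous.matrix_mulVec continuous_const continuous_id)).continuousOn
    · exact (Continuous.dotProduct continuous_id
        (Continuous.matrix_mulVec continuous_const continuous_id)).continuousOn
    · intro x hx; exact (hTpos x (hne x hx)).ne'
  obtain ⟨z, hz, hmin⟩ := (isCompact_sphere (0 : Fin n → ℝ) 1).exists_isMinOn
    ⟨_, hnorm x0 hx0'⟩ hqc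
  have hminall : ∀ x : Fin n → ℝ, x ≠ 0 → q z ≤ q x := by
    intro x hx
    have := hmin (hnorm x hx)
    simp only [Set.mem_ofPred_eq] at this
    rwa [hqs _ _ (inv_ne_zero (norm_ne_zero_iff.2 hx))] at this
  have hz0 := hne z hz
  have ht : q z < 0 := (hminall x0 hx0').trans_lt (div_neg_of_neg_of_pos hx0 (hTpos x0 hx0'))
  generalize hts : q z = t at *
  have hYq : ∀ x : Fin n → ℝ, x ⬝ᵥ (X - t • T) *ᵥ x = x ⬝ᵥ X *ᵥ x - t * (x ⬝ᵥ T *ᵥ x) := by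
    intro x
    simp [sub_mulVec, smul_mulVec, dotProduct_sub]
  have hY : (X - t • T).PosSemidef := by
    refine .of_dotProduct_mulVec_nonneg (hXh.sub ?_) ?_
    · have := hT.isHermitian
      simp [IsHermitian] at this ⊢
      rw [this]
    · intro x
      rw [star_trivial, hYq]
      by_cases hx : x = 0
      · simp [hx]
      · have := hminall x hx
        rw [le_div_iff₀ (hTpos x hx)] at this
        linarith
  have hYL : ((X - t • T) - lyapOp F G σ (X - t • T)).PosDef := by
    have e : (X - t • T) - lyapOp F G σ (X - t • T)
        = (X - lyapOp F G σ X) + (-t) • (T - lyapOp F G σ T) := by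
      rw [lyapOp_sub, lyapOp_smul, neg_smul, smul_sub]; abel
    rw [e]
    exact PosDef.posSemidef_add hX (hTL.smul (neg_pos.2 ht))
  have hYP : (X - t • T).PosDef := by
    have := hYL.add_posSemidef (lyapOp_psd F G σ hY)
    rwa [sub_add_cancel] at this
  have h1 := hYP.dotProduct_mulVec_pos hz0
  rw [star_trivial, hYq, ← hts] at h1
  simp only [q] at h1
  rw [div_mul_cancel₀ _ (hTpos z hz0).ne'] at h1
  simp at h1

/-- running cost -/
def runCost {n m : ℕ} (Q : Matrix (Fin n) (Fin n) ℝ) (S : Matrix (Fin m) (Fin n) ℝ)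
    (R : Matrix (Fin m) (Fin m) ℝ) (K : Matrix (Fin m) (Fin n) ℝ) : Matrix (Fin n) (Fin n) ℝ :=
  Kᵀ * R * K + Kᵀ * S + Sᵀ * K + Q

lemma runCost_pd {n m : ℕ} {Q : Matrix (Fin n) (Fin n) ℝ} {S : Matrix (Fin m) (Fin n) ℝ}
    {R : Matrix (Fin m) (Fin m) ℝ} (hR : R.PosDef) (hQS : (Q - Sᵀ * R⁻¹ * S).PosDef)
    (K : Matrix (Fin m) (Fin n) ℝ) : (runCost Q S R K).PosDef := by
  have hRt : Rᵀ = R := by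
    have := hR.isHermitian
    rwa [IsHermitian, conjTranspose_eq_transpose_of_trivial] at this
  have hu : IsUnit R.det := (isUnit_iff_isUnit_det R).1 hR.isUnit
  have h1 := hR.posSemidef.conjTranspose_mul_mul_same (K + R⁻¹ * S)
  rw [conjTranspose_eq_transpose_of_trivial] at h1
  have e : runCost Q S R K = (K + R⁻¹ * S)ᵀ * R * (K + R⁻¹ * S) + (Q - Sᵀ * R⁻¹ * S) := by
    have a1 : R * (R⁻¹ * S) = S := mul_nonsing_inv_cancel_left _ _ hu
    have a2 : R⁻¹ * (R * K) = K := nonsing_inv_mul_cancel_left _ _ hu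
    simp only [runCost, transpose_add, transpose_mul, transpose_nonsing_inv, hRt,
      Matrix.mul_add, Matrix.add_mul, Matrix.mul_assoc, a1, a2]
    abel
  rw [e]
  exact PosDef.posSemidef_add h1 hQS

lemma cost_diff {n m : ℕ} (A C : Matrix (Fin n) (Fin n) ℝ) (B D : Matrix (Fin n) (Fin m) ℝ)
    (σ : ℝ) (Q : Matrix (Fin n) (Fin n) ℝ) (S : Matrix (Fin m) (Fin n) ℝ)
    (R : Matrix (Fin m) (Fin m) ℝ) (hR : Rᵀ = R) (P : Matrix (Fin n) (Fin n) ℝ) (hP : Pᵀ = P)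
    (K K' : Matrix (Fin m) (Fin n) ℝ)
    (hK' : (R + Bᵀ * P * B + σ ^ 2 • (Dᵀ * P * D)) * K' =
      -(Bᵀ * P * A + σ ^ 2 • (Dᵀ * P * C) + S)) :
    lyapOp (A + B * K) (C + D * K) σ P + runCost Q S R K
      - (lyapOp (A + B * K') (C + D * K') σ P + runCost Q S R K') =
    (K - K')ᵀ * (R + Bᵀ * P * B + σ ^ 2 • (Dᵀ * P * D)) * (K - K') := by
  set W := R + Bᵀ * P * B + σ ^ 2 • (Dᵀ * P * D) with hW
  set V := Bᵀ * P * A + σ ^ 2 • (Dᵀ * P * C) + S with hV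
  have hWt : Wᵀ = W := by
    simp [hW, hR, hP, Matrix.mul_assoc]
  have hVt : Vᵀ = Aᵀ * P * B + σ ^ 2 • (Cᵀ * P * D) + Sᵀ := by
    simp [hV, hP, Matrix.mul_assoc]
  have hK't : K'ᵀ * W = -Vᵀ := by
    have := congrArg transpose hK'
    rwa [transpose_mul, hWt, transpose_neg] at this
  have H : ∀ L : Matrix (Fin m) (Fin n) ℝ,
      lyapOp (A + B * L) (C + D * L) σ P + runCost Q S R L =
      Lᵀ * W * L + Lᵀ * V + Vᵀ * L + (Aᵀ * P * A + σ ^ 2 • (Cᵀ * P * C) + Q) := by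
    intro L
    rw [hVt, hW, hV]
    simp only [lyapOp, runCost, transpose_add, transpose_mul, Matrix.mul_add, Matrix.add_mul,
      Matrix.mul_assoc, Matrix.mul_smul, Matrix.smul_mul, smul_add]
    abel
  rw [H, H, transpose_sub, Matrix.sub_mul, hK't]
  have e1 : Kᵀ * W * K' = - (Kᵀ * V) := by rw [Matrix.mul_assoc, hK', Matrix.mul_neg]
  have e2 : K'ᵀ * V = Vᵀ * K' := by
    have : K'ᵀ * (W * K') = (K'ᵀ * W) * K' := (Matrix.mul_assoc _ _ _).symm
    rw [hK', hK't, Matrix.mul_neg, Matrix.neg_mul] at this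
    exact neg_injective this
  rw [Matrix.sub_mul, Matrix.mul_sub, Matrix.mul_sub, e1, e2, Matrix.neg_mul, Matrix.neg_mul]
  abel

theorem policy_iteration_monotone
    (n m : ℕ) (hn : 0 < n) (hm : 0 < m)
    (A C : Matrix (Fin n) (Fin n) ℝ) (B D : Matrix (Fin n) (Fin m) ℝ)
    (σ : ℝ) (hσ : 0 < σ)
    (Q : Matrix (Fin n) (Fin n) ℝ) (hQ : Q.IsSymm)
    (S : Matrix (Fin m) (Fin n) ℝ)
    (R : Matrix (Fin m) (Fin m) ℝ) (hR : R.PosDef)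
    (hQS : (Q - Sᵀ * R⁻¹ * S).PosDef)
    (K : ℕ → Matrix (Fin m) (Fin n) ℝ)
    (P : ℕ → Matrix (Fin n) (Fin n) ℝ)
    (hK0 : IsStabilizer A C B D σ (K 0))
    (hPsymm : ∀ i, (P (i + 1)).IsSymm)
    (hlyap : ∀ i, (A + B * K i)ᵀ * P (i + 1) * (A + B * K i) +
        σ ^ 2 • ((C + D * K i)ᵀ * P (i + 1) * (C + D * K i)) +
        (K i)ᵀ * R * K i + (K i)ᵀ * S + Sᵀ * K i + Q - P (i + 1) = 0)
    (hupd : ∀ i, K (i + 1) =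
        -(R + Bᵀ * P (i + 1) * B + σ ^ 2 • (Dᵀ * P (i + 1) * D))⁻¹ *
          (Bᵀ * P (i + 1) * A + σ ^ 2 • (Dᵀ * P (i + 1) * C) + S)) :
    ∀ i, 1 ≤ i → (P i - P (i + 1)).PosSemidef := by
  have hRt : Rᵀ = R := by
    have := hR.isHermitian
    rwa [IsHermitian, conjTranspose_eq_transpose_of_trivial] at this
  have hly : ∀ i, lyapOp (A + B * K i) (C + D * K i) σ (P (i + 1)) + runCost Q S R (K i)
      = P (i + 1) := by
    intro i
    rw [← sub_eq_zero, ← hlyap i]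
    simp only [lyapOp, runCost]
    abel
  have hstab : ∀ i, IsStabilizer A C B D σ (K i) → (P (i + 1)).PosDef := by
    rintro i ⟨T, hT, hTL⟩
    rw [neg_sub] at hTL
    have hc := runCost_pd hR hQS (K i)
    have e : P (i + 1) - lyapOp (A + B * K i) (C + D * K i) σ (P (i + 1))
        = runCost Q S R (K i) := by
      rw [sub_eq_iff_eq_add', hly i]
    have h1 := lyap_key (A + B * K i) (C + D * K i) σ hT hTL (hPsymm i)
      (by rw [e]; exact hc.posSemidef)
    rw [← hly i]
    exact PosDef.posSemidef_add (lyapOp_psd _ _ _ h1) hc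
  have hdiff : ∀ i, (P (i + 1)).PosDef →
      (P (i + 1) - (lyapOp (A + B * K (i + 1)) (C + D * K (i + 1)) σ (P (i + 1))
        + runCost Q S R (K (i + 1)))).PosSemidef := by
    intro i hP
    have hW : (R + Bᵀ * P (i + 1) * B + σ ^ 2 • (Dᵀ * P (i + 1) * D)).PosDef := by
      have h1 := hP.posSemidef.conjTranspose_mul_mul_same B
      have h2 := hP.posSemidef.conjTranspose_mul_mul_same D
      rw [conjTranspose_eq_transpose_of_trivial] at h1 h2
      exact (hR.add_posSemidef h1).add_posSemidef (h2.smul (sq_nonneg σ))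
    have hu := (isUnit_iff_isUnit_det _).1 hW.isUnit
    have hd := cost_diff A C B D σ Q S R hRt (P (i + 1)) (hPsymm i) (K i) (K (i + 1)) (by
      rw [hupd i, Matrix.neg_mul, Matrix.mul_neg, mul_nonsing_inv_cancel_left _ _ hu])
    rw [hly i] at hd
    rw [hd]
    have h3 := hW.posSemidef.conjTranspose_mul_mul_same (K i - K (i + 1))
    rwa [conjTranspose_eq_transpose_of_trivial] at h3
  have hLpd : ∀ i, (P (i + 1)).PosDef →
      (P (i + 1) - lyapOp (A + B * K (i + 1)) (C + D * K (i + 1)) σ (P (i + 1))).PosDef := by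
    intro i hP
    have := (runCost_pd hR hQS (K (i + 1))).add_posSemidef (hdiff i hP)
    convert this using 1
    abel
  have hall : ∀ i, IsStabilizer A C B D σ (K i) := by
    intro i
    induction i with
    | zero => exact hK0
    | succ i ih =>
      have hP := hstab i ih
      refine ⟨P (i + 1), hP, ?_⟩
      rw [neg_sub]
      exact hLpd i hP
  intro i hi
  obtain ⟨j, rfl⟩ : ∃ j, i = j + 1 := ⟨i - 1, by omega⟩
  have hP := hstab j (hall j)
  refine lyap_key _ _ σ hP (hLpd j hP) ((hPsymm j).sub (hPsymm (j + 1))) ?_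
  have h := hdiff j hP
  convert h using 1
  rw [lyapOp_sub]
  rw [eq_sub_of_add_eq' (hly (j + 1))]
  abel
end

section
/- Let n, m be positive integers, A, C ∈ ℝ^{n×n}, B, D ∈ ℝ^{n×m}, σ > 0, Q ∈ ℝ^{n×n} symmetric, S ∈ ℝ^{m×n}, R ∈ ℝ^{m×m} symmetric positive definite with Q − Sᵀ R⁻¹ S positive definite. Let P be a symmetric positive semidefinite matrix satisfying the stochastic algebraic Riccati equation P = Q + Aᵀ P A + σ² Cᵀ P C − (Bᵀ P A + σ² Dᵀ P C + S)ᵀ (R + Bᵀ P B + σ² Dᵀ P D)⁻¹ (Bᵀ P A + σ² Dᵀ P C + S), and set K = −(R + Bᵀ P B + σ² Dᵀ P D)⁻¹ (Bᵀ P A + σ² Dᵀ P C + S). If K is a stabilizer, then P is positive definite. -/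
open Matrix Filter

theorem sare_solution_posdef_of_stabilizing_gain
    (n m : ℕ) (hn : 0 < n) (hm : 0 < m)
    (A C : Matrix (Fin n) (Fin n) ℝ) (B D : Matrix (Fin n) (Fin m) ℝ)
    (σ : ℝ) (hσ : 0 < σ)
    (Q : Matrix (Fin n) (Fin n) ℝ) (hQ : Q.IsSymm)
    (S : Matrix (Fin m) (Fin n) ℝ)
    (R : Matrix (Fin m) (Fin m) ℝ) (hR : R.PosDef)
    (hQS : (Q - Sᵀ * R⁻¹ * S).PosDef)
    (P : Matrix (Fin n) (Fin n) ℝ) (hP : P.PosSemidef)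
    (hsare : P = Q + Aᵀ * P * A + σ ^ 2 • (Cᵀ * P * C) -
        (Bᵀ * P * A + σ ^ 2 • (Dᵀ * P * C) + S)ᵀ *
          (R + Bᵀ * P * B + σ ^ 2 • (Dᵀ * P * D))⁻¹ *
          (Bᵀ * P * A + σ ^ 2 • (Dᵀ * P * C) + S))
    (K : Matrix (Fin m) (Fin n) ℝ)
    (hK : K = -(R + Bᵀ * P * B + σ ^ 2 • (Dᵀ * P * D))⁻¹ *
        (Bᵀ * P * A + σ ^ 2 • (Dᵀ * P * C) + S))
    (hKstab : IsStabilizer A C B D σ K) :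
    P.PosDef := by
  have hPt : Pᵀ = P := by
    have := hP.isHermitian.eq
    rwa [conjTranspose_eq_transpose_of_trivial] at this
  have hRt : Rᵀ = R := by
    have := hR.isHermitian.eq
    rwa [conjTranspose_eq_transpose_of_trivial] at this
  have hRu : IsUnit R.det := (Matrix.isUnit_iff_isUnit_det R).1 hR.isUnit
  have hcong : ∀ {k l : ℕ} (X : Matrix (Fin k) (Fin k) ℝ) (Y : Matrix (Fin k) (Fin l) ℝ),
      X.PosSemidef → (Yᵀ * X * Y).PosSemidef := by
    intro k l X Y hX
    have := hX.conjTranspose_mul_mul_same Y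
    rwa [conjTranspose_eq_transpose_of_trivial] at this
  have hs : (0:ℝ) ≤ σ ^ 2 := sq_nonneg σ
  have hM : (R + Bᵀ * P * B + σ ^ 2 • (Dᵀ * P * D)).PosDef :=
    (hR.add_posSemidef (hcong P B hP)).add_posSemidef ((hcong P D hP).smul hs)
  have hMu := (Matrix.isUnit_iff_isUnit_det _).1 hM.isUnit
  have hMK : (R + Bᵀ * P * B + σ ^ 2 • (Dᵀ * P * D)) * K =
      -(Bᵀ * P * A + σ ^ 2 • (Dᵀ * P * C) + S) := by
    rw [hK, Matrix.neg_mul, Matrix.mul_neg, Matrix.mul_nonsing_inv_cancel_left _ _ hMu]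
  have h1 : P = Q + Aᵀ * P * A + σ ^ 2 • (Cᵀ * P * C) +
      (Bᵀ * P * A + σ ^ 2 • (Dᵀ * P * C) + S)ᵀ * K := by
    rw [hK, Matrix.neg_mul, Matrix.mul_neg, ← Matrix.mul_assoc, ← sub_eq_add_neg]
    exact hsare
  have h2 : Kᵀ * ((R + Bᵀ * P * B + σ ^ 2 • (Dᵀ * P * D)) * K) +
      Kᵀ * (Bᵀ * P * A + σ ^ 2 • (Dᵀ * P * C) + S) = 0 := by
    rw [hMK, Matrix.mul_neg, neg_add_cancel]
  have hRit : (R⁻¹)ᵀ = R⁻¹ := by rw [Matrix.transpose_nonsing_inv, hRt]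
  have hsq : (K + R⁻¹ * S)ᵀ * R * (K + R⁻¹ * S) =
      Kᵀ * R * K + Kᵀ * S + Sᵀ * K + Sᵀ * R⁻¹ * S := by
    have e1 : R * (K + R⁻¹ * S) = R * K + S := by
      rw [Matrix.mul_add, Matrix.mul_nonsing_inv_cancel_left _ _ hRu]
    have e2 : R⁻¹ * (R * K) = K := Matrix.nonsing_inv_mul_cancel_left _ _ hRu
    rw [Matrix.mul_assoc, e1, transpose_add, transpose_mul, hRit]
    simp only [Matrix.mul_add, Matrix.add_mul, Matrix.mul_assoc, e2]
    abel
  have key : P = (Q - Sᵀ * R⁻¹ * S) + ((K + R⁻¹ * S)ᵀ * R * (K + R⁻¹ * S) +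
      ((A + B * K)ᵀ * P * (A + B * K) + σ ^ 2 • ((C + D * K)ᵀ * P * (C + D * K)))) := by
    rw [hsq]
    refine h1.trans ?_
    rw [← sub_eq_zero, ← neg_eq_zero, ← h2]
    simp only [Matrix.mul_add, Matrix.add_mul, Matrix.mul_assoc, transpose_add, transpose_mul,
      transpose_smul, transpose_transpose, hPt, Matrix.smul_mul, Matrix.mul_smul, smul_add]
    abel
  rw [key]
  exact hQS.add_posSemidef ((hcong R _ hR.posSemidef).add
    ((hcong P _ hP).add ((hcong P _ hP).smul hs)))
end
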